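/- arXiv:2302.05273 — 2 statements merged into one kernel-verified Lean document; each statement's English description precedes it below -/
import Mathlib

section
/- Fix an even φ ∈ C_c^∞(ℝ), 0 ≤ φ ≤ 1, with φ(x) = 1 for |x| ≤ 1 and φ(x) = 0 for |x| ≥ 2, and define the cutoffs φ_ℓ⁽ⁿ⁾ from φ as in the context. Then there exists a constant C ≥ 1 (depending only on φ) such that for every integer n ≥ 1, every Schwartz function f, and every t ≥ 0, ‖e^{it⟨D⟩}f‖_{L^∞(ℝ)} ≤ C (n/⟨t⟩^{1/2}) · B_n(f), where B_n(f) := ‖⟨ξ⟩² f̂(ξ)‖_{L²_ξ} + max_{0 ≤ ℓ ≤ n} 2^{−ℓ/2} ‖φ_ℓ⁽ⁿ⁾(ξ) ⟨ξ⟩² ∂_ξ f̂(ξ)‖_{L²_ξ}. -/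
open MeasureTheory Filter Topology

noncomputable section

/-- The Fourier transform `f̂(ξ) = (2π)^{-1/2} ∫ e^{-ixξ} f(x) dx`. -/
def FT (f : ℝ → ℂ) (ξ : ℝ) : ℂ :=
  (Real.sqrt (2 * Real.pi) : ℂ)⁻¹ * ∫ x : ℝ, Complex.exp (-(Complex.I * (x : ℂ) * (ξ : ℂ))) * f x

/-- The half Klein–Gordon propagator
`(e^{it⟨D⟩}f)(x) = (2π)^{-1/2} ∫ e^{ixξ} e^{it⟨ξ⟩} f̂(ξ) dξ`. -/
def propagator (t : ℝ) (f : ℝ → ℂ) (x : ℝ) : ℂ :=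
  (Real.sqrt (2 * Real.pi) : ℂ)⁻¹ *
    ∫ ξ : ℝ, Complex.exp (Complex.I * ((x * ξ + t * Real.sqrt (1 + ξ ^ 2) : ℝ) : ℂ)) * FT f ξ

/-- The cutoffs `φ_ℓ⁽ⁿ⁾` adapted to the problematic frequencies `±√3`, built from an
even bump function `φ` (with `ψ(x) = φ(x) − φ(2x)`). -/
def cutoff (φ : ℝ → ℝ) (n ℓ : ℕ) (ξ : ℝ) : ℝ :=
  if ℓ = 0 then 1 - φ (2 ^ 101 * (|ξ| - Real.sqrt 3))
  else if ℓ = n then φ (2 ^ (n + 100) * (|ξ| - Real.sqrt 3))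
  else φ (2 ^ (ℓ + 100) * (|ξ| - Real.sqrt 3)) - φ (2 ^ (ℓ + 101) * (|ξ| - Real.sqrt 3))

/-- The adapted weighted norm
`B_n(f) = ‖⟨ξ⟩² f̂‖_{L²} + max_{0 ≤ ℓ ≤ n} 2^{−ℓ/2} ‖φ_ℓ⁽ⁿ⁾ ⟨ξ⟩² ∂_ξ f̂‖_{L²}`. -/
def Bn (φ : ℝ → ℝ) (n : ℕ) (f : ℝ → ℂ) : ℝ :=
  (∫ ξ : ℝ, ‖((1 + ξ ^ 2 : ℝ) : ℂ) * FT f ξ‖ ^ 2) ^ ((1 : ℝ) / 2) +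
    ⨆ ℓ : Fin (n + 1),
      (2 : ℝ) ^ (-(((ℓ : ℕ) : ℝ)) / 2) *
        (∫ ξ : ℝ, ‖(cutoff φ n (ℓ : ℕ) ξ : ℂ) * ((1 + ξ ^ 2 : ℝ) : ℂ) *
            deriv (FT f) ξ‖ ^ 2) ^ ((1 : ℝ) / 2)


open scoped FourierTransform in
lemma aux_FT_schwartz (f : SchwartzMap ℝ ℂ) : ∃ g : SchwartzMap ℝ ℂ, ∀ ξ, g ξ = FT (⇑f) ξ := by
  have h2 : ((2 * Real.pi)⁻¹ : ℝ) ≠ 0 := by positivity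
  let e : ℝ ≃L[ℝ] ℝ := ContinuousLinearEquiv.unitsEquivAut ℝ (Units.mk0 _ h2)
  refine ⟨(Real.sqrt (2 * Real.pi) : ℂ)⁻¹ • SchwartzMap.compCLMOfContinuousLinearEquiv ℂ e (𝓕 f), ?_⟩
  intro ξ
  have he : e ξ = ξ * (2 * Real.pi)⁻¹ := by simp [e]
  rw [smul_apply, SchwartzMap.compCLMOfContinuousLinearEquiv_apply, FT, smul_eq_mul]
  congr 1
  rw [Function.comp_apply, he, SchwartzMap.fourier_coe, Real.fourier_real_eq_integral_exp_smul]
  congr 1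
  ext x
  rw [smul_eq_mul]
  congr 2
  have : (Real.pi : ℂ) ≠ 0 := by exact_mod_cast Real.pi_ne_zero
  push_cast
  field_simp

lemma aux_mul_schwartz (g : SchwartzMap ℝ ℂ) :
    ∃ h : SchwartzMap ℝ ℂ, ∀ ξ, h ξ = ((1 + ξ ^ 2 : ℝ) : ℂ) * g ξ := by
  have hT : (fun ξ : ℝ => (1 + ξ ^ 2 : ℝ)).HasTemperateGrowth := by fun_prop
  refine ⟨SchwartzMap.smulLeftCLM ℂ (fun ξ : ℝ => (1 + ξ ^ 2 : ℝ)) g, ?_⟩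
  intro ξ
  rw [SchwartzMap.smulLeftCLM_apply_apply hT]
  simp

lemma aux_deriv_schwartz (g : SchwartzMap ℝ ℂ) :
    ∃ h : SchwartzMap ℝ ℂ, ∀ ξ, h ξ = deriv (⇑g) ξ :=
  ⟨SchwartzMap.derivCLM ℝ ℂ g, fun ξ => by simp⟩

/-- Cauchy-Schwarz. -/
lemma aux_CS (u v : ℝ → ℝ) (hu0 : ∀ x, 0 ≤ u x) (hv0 : ∀ x, 0 ≤ v x) (hu : MemLp u 2 volume)
    (hv : MemLp v 2 volume) :
    ∫ x, u x * v x ≤ (∫ x, u x ^ 2) ^ ((1:ℝ)/2) * (∫ x, v x ^ 2) ^ ((1:ℝ)/2) := by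
  have h2 : ENNReal.ofReal 2 = 2 := by norm_num
  have := integral_mul_le_Lp_mul_Lq_of_nonneg (μ := volume) (p := 2) (q := 2) (f := u) (g := v)
    (Real.HolderConjugate.two_two) (ae_of_all _ hu0) (ae_of_all _ hv0) (by rwa [h2]) (by rwa [h2])
  simpa using this

/-- The Lorentzian. -/
def lor (l s : ℝ) : ℝ := l / (1 + l ^ 2 * s ^ 2)

lemma lor_nonneg {l : ℝ} (hl : 0 < l) (s : ℝ) : 0 ≤ lor l s := by
  unfold lor; positivity

lemma lor_integrable {l : ℝ} (hl : 0 < l) (a : ℝ) : Integrable (fun s => lor l (s - a)) := by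
  have h1 : Integrable (fun s : ℝ => (1 + (l * s) ^ 2)⁻¹) :=
    integrable_inv_one_add_sq.comp_mul_left' hl.ne'
  have h2 := (h1.const_mul l).comp_sub_right a
  refine h2.congr (ae_of_all _ fun s => ?_)
  simp [lor, mul_pow, div_eq_mul_inv]

lemma lor_integral {l : ℝ} (hl : 0 < l) (a : ℝ) : ∫ s, lor l (s - a) = Real.pi := by
  rw [integral_sub_right_eq_self (fun s => lor l s) a]
  have : ∀ s, lor l s = l * (fun y : ℝ => (1 + y ^ 2)⁻¹) (l * s) := by
    intro s; simp [lor, mul_pow, div_eq_mul_inv]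
  simp_rw [this]
  rw [integral_const_mul, Measure.integral_comp_mul_left (fun y : ℝ => (1 + y ^ 2)⁻¹) l, integral_univ_inv_one_add_sq]
  rw [abs_of_pos (by positivity), smul_eq_mul]
  field_simp

/-- The bracket. -/
def jb (ξ : ℝ) : ℝ := Real.sqrt (1 + ξ ^ 2)
/-- Derivative of the phase. -/
def phd (x t ξ : ℝ) : ℝ := x + t * (ξ / jb ξ)
/-- Reference size of the square of the phase derivative. -/
def MM (t ξ : ℝ) : ℝ := t / jb ξ ^ 3 + 1 / jb ξ ^ 2
/-- Multiplier used in the integration by parts. -/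
def ww (x t ξ : ℝ) : ℝ := phd x t ξ / (phd x t ξ ^ 2 + MM t ξ)
/-- Localisation to the stationary region. -/
def kk (x t ξ : ℝ) : ℝ := MM t ξ / (phd x t ξ ^ 2 + MM t ξ)

lemma jb_pos (ξ : ℝ) : 0 < jb ξ := by unfold jb; positivity
lemma jb_sq (ξ : ℝ) : jb ξ ^ 2 = 1 + ξ ^ 2 := by unfold jb; exact Real.sq_sqrt (by positivity)
lemma jb_ge_one (ξ : ℝ) : 1 ≤ jb ξ := by
  have := jb_sq ξ; have := jb_pos ξ; nlinarith [sq_nonneg ξ]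
lemma abs_le_jb (ξ : ℝ) : |ξ| ≤ jb ξ := by
  apply abs_le_of_sq_le_sq _ (jb_pos ξ).le
  rw [jb_sq]; linarith
lemma jb_neg (ξ : ℝ) : jb (-ξ) = jb ξ := by simp [jb]
lemma jb_lip (ξ η : ℝ) : jb ξ ≤ jb η + |ξ - η| := by
  have h1 := jb_sq ξ; have h2 := jb_sq η
  have h3 := abs_le_jb η
  have h4 := jb_pos η
  have h5 := abs_nonneg (ξ - η)
  apply le_of_sq_le_sq _ (by positivity)
  have : η * (ξ - η) ≤ jb η * |ξ - η| := by
    calc η * (ξ - η) ≤ |η * (ξ - η)| := le_abs_self _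
      _ = |η| * |ξ - η| := abs_mul _ _
      _ ≤ _ := by gcongr
  nlinarith [sq_abs (ξ - η)]

lemma MM_pos {t : ℝ} (ht : 0 ≤ t) (ξ : ℝ) : 0 < MM t ξ := by
  have := jb_pos ξ
  unfold MM; positivity

lemma kk_nonneg {t : ℝ} (ht : 0 ≤ t) (x ξ : ℝ) : 0 ≤ kk x t ξ := by
  have := MM_pos ht ξ
  unfold kk; positivity

lemma kk_le_one {t : ℝ} (ht : 0 ≤ t) (x ξ : ℝ) : kk x t ξ ≤ 1 := by
  have := MM_pos ht ξ
  unfold kk; apply div_le_one_of_le₀ <;> nlinarith [sq_nonneg (phd x t ξ)]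

lemma hasDerivAt_jb (ξ : ℝ) : HasDerivAt jb (ξ / jb ξ) ξ := by
  have h : HasDerivAt (fun ξ : ℝ => 1 + ξ ^ 2) (2 * ξ) ξ := by
    simpa using (hasDerivAt_pow 2 ξ).const_add 1
  have h2 : HasDerivAt jb (2 * ξ / (2 * Real.sqrt (1 + ξ ^ 2))) ξ := h.sqrt (by positivity)
  refine h2.congr_deriv ?_
  unfold jb
  field_simp

lemma hasDerivAt_phd (x t ξ : ℝ) : HasDerivAt (phd x t) (t / jb ξ ^ 3) ξ := by
  have hp := jb_pos ξ
  have h : HasDerivAt (phd x t) (t * ((1 * jb ξ - ξ * (ξ / jb ξ)) / jb ξ ^ 2)) ξ :=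
    (((hasDerivAt_id ξ).div (hasDerivAt_jb ξ) hp.ne').const_mul t).const_add x
  refine h.congr_deriv ?_
  have := jb_sq ξ
  field_simp
  rw [this]; ring

lemma hasDerivAt_MM (t ξ : ℝ) :
    HasDerivAt (MM t) (-(3 * t / jb ξ ^ 4 + 2 / jb ξ ^ 3) * (ξ / jb ξ)) ξ := by
  have hp := jb_pos ξ
  have h3 := ((hasDerivAt_jb ξ).pow 3)
  have h2 := ((hasDerivAt_jb ξ).pow 2)
  have h := ((hasDerivAt_const ξ t).div h3 (pow_pos hp 3).ne').add
    ((hasDerivAt_const ξ (1:ℝ)).div h2 (pow_pos hp 2).ne')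
  refine HasDerivAt.congr_deriv (f := MM t) h ?_
  simp only [Pi.pow_apply]
  norm_num
  field_simp
  ring

lemma hasDerivAt_ww {t : ℝ} (ht : 0 ≤ t) (x ξ : ℝ) :
    ∃ w' : ℝ, HasDerivAt (ww x t) w' ξ ∧ |w'| ≤ 3 * kk x t ξ := by
  have hX := jb_pos ξ
  have hM := MM_pos ht ξ
  have hD : 0 < phd x t ξ ^ 2 + MM t ξ := by positivity
  have h := (hasDerivAt_phd x t ξ).div
    (((hasDerivAt_phd x t ξ).pow 2).add (hasDerivAt_MM t ξ)) hD.ne'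
  refine ⟨_, h, ?_⟩
  set a := phd x t ξ with ha
  set M' := -(3 * t / jb ξ ^ 4 + 2 / jb ξ ^ 3) * (ξ / jb ξ) with hM'
  set M := MM t ξ with hMdef
  have hk : kk x t ξ = M / (a ^ 2 + M) := rfl
  have h1 : |M'| ≤ 3 * M / jb ξ := by
    have hv : |ξ / jb ξ| ≤ 1 := by
      rw [abs_div, abs_of_pos hX]; exact div_le_one_of_le₀ (abs_le_jb ξ) hX.le
    rw [hM', abs_mul, abs_neg, abs_of_nonneg (by positivity)]
    calc _ ≤ (3 * t / jb ξ ^ 4 + 2 / jb ξ ^ 3) * 1 := by gcongr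
      _ ≤ (3 * t / jb ξ ^ 4 + 3 / jb ξ ^ 3) * 1 := by gcongr; norm_num
      _ = _ := by rw [hMdef, MM]; field_simp
  have h2 : t / jb ξ ^ 3 ≤ M := by
    rw [hMdef, MM]; have : 0 < 1 / jb ξ ^ 2 := by positivity
    linarith
  have h2' : 0 ≤ t / jb ξ ^ 3 := by positivity
  have h3 : 1 / jb ξ ^ 2 ≤ M := by
    rw [hMdef, MM]; linarith
  have h4 : |a * M'| ≤ 3 / 2 * M * (a ^ 2 + M) := by
    rw [abs_mul]
    calc |a| * |M'| ≤ |a| * (3 * M / jb ξ) := by gcongr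
      _ = 3 * M * (|a| * (1 / jb ξ)) := by ring
      _ ≤ 3 * M * ((a ^ 2 + M) / 2) := by
        gcongr
        have : (1 / jb ξ) ^ 2 ≤ M := by rw [div_pow, one_pow]; exact h3
        nlinarith [sq_nonneg (|a| - 1 / jb ξ), sq_abs a]
      _ = _ := by ring
  rw [hk]
  simp only [Pi.add_apply, Pi.pow_apply]
  rw [← ha, ← hMdef, abs_div, abs_of_pos (by positivity : 0 < (a ^ 2 + M) ^ 2), div_le_iff₀ (by positivity)]
  have : 3 * (M / (a ^ 2 + M)) * (a ^ 2 + M) ^ 2 = 3 * M * (a ^ 2 + M) := by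
    field_simp
  rw [this]
  have h5 := abs_le.1 h4
  have h6 : t / jb ξ ^ 3 * a ^ 2 ≤ M * a ^ 2 := by gcongr
  have h7 : t / jb ξ ^ 3 * M ≤ M * M := by gcongr
  have h8 : 0 ≤ t / jb ξ ^ 3 * a ^ 2 := by positivity
  have h9 : 0 ≤ t / jb ξ ^ 3 * M := by positivity
  have h10 : 0 ≤ M * a ^ 2 := by positivity
  have h11 : 0 ≤ M * M := by positivity
  norm_num
  rw [abs_le]
  constructor <;> nlinarith

lemma ww_sq_le {t : ℝ} (ht : 0 ≤ t) (x ξ : ℝ) : ww x t ξ ^ 2 ≤ kk x t ξ / MM t ξ := by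
  have hM := MM_pos ht ξ
  have hD : 0 < phd x t ξ ^ 2 + MM t ξ := by positivity
  unfold ww kk
  rw [div_pow, div_div, div_le_div_iff₀ (by positivity) (by positivity)]
  have : MM t ξ * (phd x t ξ ^ 2 + MM t ξ) ^ 2 = (phd x t ξ ^ 2 + MM t ξ) * ((phd x t ξ ^ 2 + MM t ξ) * MM t ξ) := by ring
  rw [this]
  gcongr
  linarith

lemma ww_neg (x t ξ : ℝ) : ww x t (-ξ) ^ 2 = ww (-x) t ξ ^ 2 := by
  have : phd x t (-ξ) = - phd (-x) t ξ := by simp [phd, jb_neg]; ring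
  have h2 : MM t (-ξ) = MM t ξ := by simp [MM, jb_neg]
  unfold ww; rw [this, h2]; ring

lemma kk_neg (x t ξ : ℝ) : kk x t (-ξ) = kk (-x) t ξ := by
  have : phd x t (-ξ) = - phd (-x) t ξ := by simp [phd, jb_neg]; ring
  have h2 : MM t (-ξ) = MM t ξ := by simp [MM, jb_neg]
  unfold kk; rw [this, h2]; ring

/-- Separation of velocities. -/
lemma vel_sep {ξ η : ℝ} (h0 : 0 ≤ ξ) (h : ξ ≤ η) :
    (η - ξ) / (2 * jb ξ * jb η * jb ξ) ≤ η / jb η - ξ / jb ξ := by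
  have hX := jb_pos ξ; have hY := jb_pos η
  rcases eq_or_lt_of_le (h0.trans h) with h1 | h1
  · have : ξ = η := by linarith
    subst this; simp
  have e : η / jb η - ξ / jb ξ = (η * jb ξ - ξ * jb η) / (jb ξ * jb η) := by
    field_simp
  have hfac : (η * jb ξ - ξ * jb η) * (η * jb ξ + ξ * jb η) = η ^ 2 - ξ ^ 2 := by
    have := jb_sq ξ; have := jb_sq η
    ring_nf; simp only [jb_sq]; ring
  have hsum : 0 < η * jb ξ + ξ * jb η := by positivity
  have hnn : 0 ≤ η * jb ξ - ξ * jb η := by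
    by_contra hc
    push Not at hc
    nlinarith
  have hsum2 : η * jb ξ + ξ * jb η ≤ 2 * (η * jb ξ) := by linarith
  have key : (η - ξ) ≤ (η * jb ξ - ξ * jb η) * (2 * jb ξ) := by
    have : (η - ξ) * η ≤ (η * jb ξ - ξ * jb η) * (2 * jb ξ) * η := by
      nlinarith [mul_le_mul_of_nonneg_left hsum2 hnn, mul_nonneg (sub_nonneg.2 h) h0]
    exact le_of_mul_le_mul_right this h1
  rw [e, div_le_div_iff₀ (by positivity) (by positivity)]
  have : 0 < jb ξ * jb η := by positivity
  nlinarith [mul_le_mul_of_nonneg_right key this.le]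

lemma vel_mono {ξ η : ℝ} (h0 : 0 ≤ ξ) (h : ξ ≤ η) : ξ / jb ξ ≤ η / jb η := by
  have hX := jb_pos ξ; have hY := jb_pos η
  have := vel_sep h0 h
  have h2 : 0 ≤ (η - ξ) / (2 * jb ξ * jb η * jb ξ) := by
    apply div_nonneg (by linarith); positivity
  linarith

/-- Existence of the (truncated) stationary point. -/
lemma exists_stat {t : ℝ} (ht : 0 < t) (x : ℝ) : ∃ η : ℝ, 0 ≤ η ∧ ∀ ξ, 0 ≤ ξ → ξ ≤ t →
    t * |ξ / jb ξ - η / jb η| ≤ |phd x t ξ| := by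
  have e : ∀ ξ, |phd x t ξ| = t * |ξ / jb ξ - (-x / t)| := by
    intro ξ
    rw [← abs_of_pos ht, ← abs_mul, abs_of_pos ht, phd]
    congr 1; field_simp; ring
  simp_rw [e]
  set v := -x / t
  by_cases h1 : v ≤ 0
  · refine ⟨0, le_rfl, fun ξ hξ _ => ?_⟩
    have : 0 ≤ ξ / jb ξ := div_nonneg hξ (jb_pos ξ).le
    apply mul_le_mul_of_nonneg_left _ ht.le
    rw [zero_div, sub_zero, abs_of_nonneg this, abs_of_nonneg (by linarith)]
    linarith
  push Not at h1
  by_cases h2 : t / jb t ≤ v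
  · refine ⟨t, ht.le, fun ξ hξ hξt => ?_⟩
    have := vel_mono hξ hξt
    apply mul_le_mul_of_nonneg_left _ ht.le
    rw [abs_sub_comm, abs_of_nonneg (by linarith), abs_sub_comm, abs_of_nonneg (by linarith)]
    linarith
  push Not at h2
  have hc : ContinuousOn (fun ξ => ξ / jb ξ) (Set.Icc 0 t) := by
    intro ξ _
    have := ((hasDerivAt_id ξ).div (hasDerivAt_jb ξ) (jb_pos ξ).ne').continuousAt
    exact this.continuousWithinAt
  obtain ⟨η, hη, hv⟩ := intermediate_value_Icc ht.le hc (show v ∈ Set.Icc _ _ by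
    simp only [zero_div]; exact ⟨h1.le, h2.le⟩)
  refine ⟨η, hη.1, fun ξ _ _ => ?_⟩
  simp only at hv
  rw [hv]

/-- Pointwise bound of `kk` by a near part and a far part. -/
lemma kk_bound {t : ℝ} (ht : 1 ≤ t) (x : ℝ) : ∃ η : ℝ, 0 ≤ η ∧ ∀ ξ, 0 ≤ ξ → ξ ≤ t →
    (|ξ - η| ≤ jb η / 2 ∧ kk x t ξ ≤ 1 / (1 + t / (24 * jb η ^ 3) * (ξ - η) ^ 2)) ∨
    kk x t ξ ≤ 48 * jb ξ / t := by
  obtain ⟨η, h0, h⟩ := exists_stat (by linarith : 0 < t) x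
  refine ⟨η, h0, fun ξ hξ hξt => ?_⟩
  have hX := jb_pos ξ; have hY := jb_pos η
  have hM := MM_pos (by linarith : 0 ≤ t) ξ
  have hsep : |ξ - η| / (2 * jb ξ * jb η * min (jb ξ) (jb η)) ≤ |ξ / jb ξ - η / jb η| := by
    rcases le_total ξ η with hh | hh
    · have h1 := vel_sep hξ hh
      have h2 := vel_mono hξ hh
      have hm : min (jb ξ) (jb η) = jb ξ := min_eq_left (Real.sqrt_le_sqrt (by nlinarith))
      rw [hm, abs_sub_comm, abs_of_nonneg (by linarith), abs_sub_comm (ξ / jb ξ), abs_of_nonneg (by linarith)]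
      exact h1
    · have h1 := vel_sep h0 hh
      have h2 := vel_mono h0 hh
      have hm : min (jb ξ) (jb η) = jb η := min_eq_right (Real.sqrt_le_sqrt (by nlinarith))
      rw [hm, abs_of_nonneg (by linarith), abs_of_nonneg (by linarith)]
      convert h1 using 2; ring
  set m := min (jb ξ) (jb η) with hm
  have hm0 : 0 < m := lt_min hX hY
  have hmX : m ≤ jb ξ := min_le_left _ _
  have hmY : m ≤ jb η := min_le_right _ _
  have hX2 : jb ξ ≤ 2 * t := by
    have := jb_sq ξ
    nlinarith
  have hph : t ^ 2 * (ξ - η) ^ 2 / (4 * jb ξ ^ 2 * jb η ^ 2 * m ^ 2) ≤ phd x t ξ ^ 2 := by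
    have h3 : t * (|ξ - η| / (2 * jb ξ * jb η * m)) ≤ |phd x t ξ| :=
      (mul_le_mul_of_nonneg_left hsep (by linarith)).trans (h ξ hξ hξt)
    have h4 : (t * (|ξ - η| / (2 * jb ξ * jb η * m))) ^ 2 ≤ |phd x t ξ| ^ 2 := by
      apply pow_le_pow_left₀ _ h3
      positivity
    rw [sq_abs] at h4
    calc _ = _ := by
            rw [← sq_abs (ξ - η)]
            field_simp; ring
      _ ≤ _ := h4
  have hMle : MM t ξ ≤ 3 * t / jb ξ ^ 3 := by
    unfold MM
    have : 1 / jb ξ ^ 2 ≤ 2 * t / jb ξ ^ 3 := by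
      rw [div_le_div_iff₀ (by positivity) (by positivity)]
      nlinarith [mul_le_mul_of_nonneg_right hX2 (sq_nonneg (jb ξ))]
    calc _ ≤ t / jb ξ ^ 3 + 2 * t / jb ξ ^ 3 := by linarith
      _ = _ := by ring
  set A := t * (ξ - η) ^ 2 * jb ξ / (12 * jb η ^ 2 * m ^ 2) with hA
  have hA0 : 0 ≤ A := by positivity
  have hk : kk x t ξ ≤ 1 / (1 + A) := by
    unfold kk
    rw [div_le_div_iff₀ (by positivity) (by positivity)]
    have : MM t ξ * A ≤ phd x t ξ ^ 2 := by
      refine le_trans ?_ hph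
      calc MM t ξ * A ≤ 3 * t / jb ξ ^ 3 * A := by gcongr
        _ = _ := by rw [hA]; field_simp; ring
    linarith
  by_cases hnear : |ξ - η| ≤ jb η / 2
  · left
    refine ⟨hnear, hk.trans ?_⟩
    have hYX : jb η ≤ 2 * jb ξ := by
      have := jb_lip η ξ
      rw [abs_sub_comm] at this
      linarith
    have : t / (24 * jb η ^ 3) * (ξ - η) ^ 2 ≤ A := by
      have h1 : A ≥ t * (ξ - η) ^ 2 * (jb η / 2) / (12 * jb η ^ 2 * jb η ^ 2) := by
        rw [hA]; gcongr; linarith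
      refine le_trans (le_of_eq ?_) h1
      field_simp; ring
    gcongr
  · right
    push Not at hnear
    refine hk.trans ?_
    have h1 : t / (48 * jb ξ) ≤ A := by
      rw [hA, div_le_div_iff₀ (by positivity) (by positivity)]
      have h2 : (jb η / 2) ^ 2 * m ^ 2 ≤ |ξ - η| ^ 2 * jb ξ ^ 2 := by gcongr
      rw [sq_abs] at h2
      nlinarith [mul_le_mul_of_nonneg_left h2 (by linarith : 0 ≤ t)]
    calc 1 / (1 + A) ≤ 1 / (t / (48 * jb ξ)) := by
          gcongr; linarith
      _ = _ := by field_simp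

/-- The integrable tail `⟨ξ⟩^{-3/2}`. -/
def PP (ξ : ℝ) : ℝ := 1 / (jb ξ * Real.sqrt (jb ξ))

lemma PP_nonneg (ξ : ℝ) : 0 ≤ PP ξ := by
  have := jb_pos ξ; unfold PP; positivity

lemma PP_neg (ξ : ℝ) : PP (-ξ) = PP ξ := by simp [PP, jb_neg]

lemma PP_integrable : Integrable PP := by
  have h := integrable_rpow_neg_one_add_norm_sq (E := ℝ) (μ := volume) (r := 3 / 2) (by norm_num)
  refine h.congr (ae_of_all _ fun ξ => ?_)
  have h0 : (0:ℝ) < 1 + ξ ^ 2 := by positivity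
  simp only [PP, jb, Real.norm_eq_abs, sq_abs]
  rw [Real.sqrt_eq_rpow, Real.sqrt_eq_rpow, ← Real.rpow_mul h0.le, ← Real.rpow_add h0, one_div,
    ← Real.rpow_neg h0.le]
  norm_num

set_option maxHeartbeats 1000000 in
lemma half_bound {t : ℝ} (ht : 1 ≤ t) (x : ℝ) : ∃ η l Y : ℝ, 0 < l ∧ 0 < Y ∧ ∀ ξ, 0 ≤ ξ →
    kk x t ξ / jb ξ ^ 2 ≤ 100 / Real.sqrt t * (PP ξ + lor l (ξ - η)) ∧
    ww x t ξ ^ 2 / jb ξ ^ 4 ≤ 100 / t * (lor (1 / t) ξ + lor (1 / Y) (ξ - η)) := by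
  obtain ⟨η, h0, h⟩ := kk_bound ht x
  have hY := jb_pos η
  have hY1 := jb_ge_one η
  have ht0 : 0 < t := by linarith
  have hst : 0 < Real.sqrt t := Real.sqrt_pos.2 ht0
  have hst2 : Real.sqrt t ^ 2 = t := Real.sq_sqrt ht0.le
  have hl : 0 < Real.sqrt (t / (24 * jb η ^ 3)) := Real.sqrt_pos.2 (by positivity)
  have hl2 : Real.sqrt (t / (24 * jb η ^ 3)) ^ 2 = t / (24 * jb η ^ 3) := Real.sq_sqrt (by positivity)
  have hl3 : Real.sqrt t / (5 * jb η ^ 2) ≤ Real.sqrt (t / (24 * jb η ^ 3)) := by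
    apply Real.le_sqrt_of_sq_le
    rw [div_pow, hst2]
    gcongr
    calc 24 * jb η ^ 3 ≤ 25 * (jb η ^ 3 * jb η) := by nlinarith [pow_pos hY 3]
      _ = _ := by ring
  set l := Real.sqrt (t / (24 * jb η ^ 3))
  refine ⟨η, l, jb η, hl, hY, fun ξ hξ => ?_⟩
  have hX := jb_pos ξ
  have hM := MM_pos ht0.le ξ
  have hsX : 0 < Real.sqrt (jb ξ) := Real.sqrt_pos.2 hX
  have hsX2 : Real.sqrt (jb ξ) ^ 2 = jb ξ := Real.sq_sqrt hX.le
  have hP := PP_nonneg ξ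
  have hlor := lor_nonneg hl (ξ - η)
  have hlor1 := lor_nonneg (one_div_pos.2 ht0) ξ
  have hlor2 := lor_nonneg (one_div_pos.2 hY) (ξ - η)
  have hk1 := kk_le_one ht0.le x ξ
  have hk0 := kk_nonneg ht0.le x ξ
  have hw := ww_sq_le ht0.le x ξ
  have hc1 : 0 < 100 / Real.sqrt t := by positivity
  have hc2 : 0 < 100 / t := by positivity
  have hlorB : lor (1 / t) ξ = t / (t ^ 2 + ξ ^ 2) := by unfold lor; field_simp
  have hlorC : lor (1 / jb η) (ξ - η) = jb η / (jb η ^ 2 + (ξ - η) ^ 2) := by unfold lor; field_simp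
  have hw2 : ww x t ξ ^ 2 / jb ξ ^ 4 ≤ kk x t ξ / (t * jb ξ) := by
    have h1 : t / jb ξ ^ 3 ≤ MM t ξ := by unfold MM; linarith [show 0 < 1 / jb ξ ^ 2 by positivity]
    calc ww x t ξ ^ 2 / jb ξ ^ 4 ≤ kk x t ξ / MM t ξ / jb ξ ^ 4 := by gcongr
      _ ≤ kk x t ξ / (t / jb ξ ^ 3) / jb ξ ^ 4 := by gcongr
      _ = _ := by field_simp
  rcases le_or_gt ξ t with hξt | hξt
  · rcases h ξ hξ hξt with ⟨hn, hk⟩ | hk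
    · have hYX : jb η ≤ 2 * jb ξ := by
        have := jb_lip η ξ
        rw [abs_sub_comm] at this
        linarith
      constructor
      · calc kk x t ξ / jb ξ ^ 2 ≤ kk x t ξ / (jb η / 2) ^ 2 := by gcongr; linarith
          _ ≤ 1 / (1 + t / (24 * jb η ^ 3) * (ξ - η) ^ 2) / (jb η / 2) ^ 2 := by gcongr
          _ = 20 / Real.sqrt t * ((Real.sqrt t / (5 * jb η ^ 2)) / (1 + l ^ 2 * (ξ - η) ^ 2)) := by
            rw [hl2]; field_simp; ring
          _ ≤ 20 / Real.sqrt t * (l / (1 + l ^ 2 * (ξ - η) ^ 2)) := by gcongr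
          _ ≤ 100 / Real.sqrt t * lor l (ξ - η) := by unfold lor; gcongr; norm_num
          _ ≤ _ := by gcongr; linarith
      · have hs : (ξ - η) ^ 2 ≤ (jb η / 2) ^ 2 := by
          rw [← sq_abs (ξ - η)]; gcongr
        calc ww x t ξ ^ 2 / jb ξ ^ 4 ≤ kk x t ξ / (t * jb ξ) := hw2
          _ ≤ 1 / (t * (jb η / 2)) := by gcongr; linarith
          _ ≤ 100 / t * (jb η / (jb η ^ 2 + (jb η / 2) ^ 2)) := by
            rw [div_mul_div_comm, div_le_div_iff₀ (by positivity) (by positivity)]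
            nlinarith [show 0 < t * jb η ^ 2 by positivity]
          _ ≤ 100 / t * lor (1 / jb η) (ξ - η) := by rw [hlorC]; gcongr
          _ ≤ _ := by gcongr; linarith
    · constructor
      · have hX2 : jb ξ ≤ 2 * t := by
          have := jb_sq ξ
          nlinarith
        have hsq : Real.sqrt (jb ξ) ≤ 2 * Real.sqrt t := by
          apply le_of_sq_le_sq _ (by positivity)
          rw [mul_pow, hsX2, hst2]; linarith
        calc kk x t ξ / jb ξ ^ 2 ≤ 48 * jb ξ / t / jb ξ ^ 2 := by gcongr
          _ = 48 / Real.sqrt t * (1 / (jb ξ * Real.sqrt t)) := by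
            field_simp; rw [hst2]
          _ ≤ 48 / Real.sqrt t * (1 / (jb ξ * (Real.sqrt (jb ξ) / 2))) := by gcongr; linarith
          _ = 96 / Real.sqrt t * PP ξ := by unfold PP; field_simp; ring
          _ ≤ 100 / Real.sqrt t * PP ξ := by gcongr; norm_num
          _ ≤ _ := by gcongr; linarith
      · calc ww x t ξ ^ 2 / jb ξ ^ 4 ≤ kk x t ξ / (t * jb ξ) := hw2
          _ ≤ 48 * jb ξ / t / (t * jb ξ) := by gcongr
          _ ≤ 100 / t * (t / (t ^ 2 + t ^ 2)) := by
            rw [div_mul_div_comm, div_div, div_le_div_iff₀ (by positivity) (by positivity)]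
            nlinarith [show 0 < t ^ 3 * jb ξ * t by positivity]
          _ ≤ 100 / t * lor (1 / t) ξ := by rw [hlorB]; gcongr
          _ ≤ _ := by gcongr; linarith
  · have hXt : t ≤ jb ξ := hξt.le.trans ((le_abs_self _).trans (abs_le_jb ξ))
    constructor
    · have hsq : Real.sqrt t ≤ Real.sqrt (jb ξ) := Real.sqrt_le_sqrt hXt
      calc kk x t ξ / jb ξ ^ 2 ≤ 1 / jb ξ ^ 2 := by gcongr
        _ = 1 / Real.sqrt (jb ξ) * PP ξ := by
          unfold PP
          rw [div_mul_div_comm]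
          congr 1
          · norm_num
          · linear_combination (-jb ξ) * hsX2
        _ ≤ 100 / Real.sqrt t * PP ξ := by gcongr; norm_num
        _ ≤ _ := by gcongr; linarith
    · have h1 : 1 / jb ξ ^ 2 ≤ MM t ξ := by unfold MM; linarith [show 0 < t / jb ξ ^ 3 by positivity]
      calc ww x t ξ ^ 2 / jb ξ ^ 4 ≤ kk x t ξ / MM t ξ / jb ξ ^ 4 := by gcongr
        _ ≤ 1 / (1 / jb ξ ^ 2) / jb ξ ^ 4 := by gcongr
        _ = 1 / jb ξ ^ 2 := by field_simp
        _ ≤ 1 / ξ ^ 2 := by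
          have : 0 < ξ := by linarith
          gcongr
          exact (le_abs_self ξ).trans (abs_le_jb ξ)
        _ ≤ 100 / t * (t / (t ^ 2 + ξ ^ 2)) := by
          have : 0 < ξ := by linarith
          rw [div_mul_div_comm, div_le_div_iff₀ (by positivity) (by positivity)]
          nlinarith [mul_le_mul hξt.le hξt.le ht0.le this.le]
        _ = 100 / t * lor (1 / t) ξ := by rw [hlorB]
        _ ≤ _ := by gcongr; linarith

lemma ww_sup {t : ℝ} (ht : 1 ≤ t) (x ξ : ℝ) : ww x t ξ ^ 2 / jb ξ ^ 4 ≤ 1 / t := by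
  have hX := jb_pos ξ
  have hX1 := jb_ge_one ξ
  have ht0 : 0 < t := by linarith
  have hM := MM_pos ht0.le ξ
  have h1 : t / jb ξ ^ 3 ≤ MM t ξ := by unfold MM; linarith [show 0 < 1 / jb ξ ^ 2 by positivity]
  calc ww x t ξ ^ 2 / jb ξ ^ 4 ≤ kk x t ξ / MM t ξ / jb ξ ^ 4 := by
          gcongr; exact ww_sq_le ht0.le x ξ
    _ ≤ 1 / (t / jb ξ ^ 3) / jb ξ ^ 4 := by gcongr; exact kk_le_one ht0.le x ξ
    _ = 1 / (t * jb ξ) := by field_simp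
    _ ≤ 1 / t := by gcongr; nlinarith

lemma sum_three {a b c : ℝ → ℝ} (κ : ℝ) (ha : Integrable a) (hb : Integrable b)
    (hc : Integrable c) : ∫ ξ, κ * ((a ξ + b ξ) + c ξ) = κ * ((∫ ξ, a ξ) + (∫ ξ, b ξ) + ∫ ξ, c ξ) := by
  have hab : Integrable (fun ξ => a ξ + b ξ) := ha.add hb
  rw [integral_const_mul, integral_add hab hc, integral_add ha hb]

set_option maxHeartbeats 1000000 in
lemma full_bound : ∃ C : ℝ, 1 ≤ C ∧ ∀ t : ℝ, 1 ≤ t → ∀ x : ℝ,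
    (∃ H : ℝ → ℝ, Integrable H ∧ (∀ ξ, kk x t ξ / jb ξ ^ 2 ≤ H ξ) ∧ ∫ ξ, H ξ ≤ C / Real.sqrt t) ∧
    (∃ H : ℝ → ℝ, Integrable H ∧ (∀ ξ, ww x t ξ ^ 2 / jb ξ ^ 4 ≤ H ξ) ∧ ∫ ξ, H ξ ≤ C / t) := by
  have hI : 0 ≤ ∫ ξ, PP ξ := integral_nonneg PP_nonneg
  have hpi := Real.pi_gt_three
  refine ⟨100 * ((∫ ξ, PP ξ) + Real.pi * 3), by nlinarith, fun t ht x => ?_⟩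
  have ht0 : 0 < t := by linarith
  have hst : 0 < Real.sqrt t := Real.sqrt_pos.2 ht0
  obtain ⟨η₁, l₁, Y₁, hl₁, hY₁, h₁⟩ := half_bound ht x
  obtain ⟨η₂, l₂, Y₂, hl₂, hY₂, h₂⟩ := half_bound ht (-x)
  have e1 : ∀ l ξ, lor l (-ξ - η₂) = lor l (ξ - (-η₂)) := by
    intro l ξ; unfold lor; congr 3; ring
  have e2 : ∀ l ξ, lor l (-ξ) = lor l ξ := by
    intro l ξ; unfold lor; congr 3; ring
  have it := one_div_pos.2 ht0
  have i1 := one_div_pos.2 hY₁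
  have i2 := one_div_pos.2 hY₂
  constructor
  · refine ⟨fun ξ => 100 / Real.sqrt t * ((PP ξ + lor l₁ (ξ - η₁)) + lor l₂ (ξ - (-η₂))), ?_, ?_, ?_⟩
    · exact ((PP_integrable.add (lor_integrable hl₁ _)).add (lor_integrable hl₂ _)).const_mul _
    · intro ξ
      beta_reduce
      rcases le_total 0 ξ with hξ | hξ
      · refine ((h₁ ξ hξ).1).trans ?_
        refine mul_le_mul_of_nonneg_left ?_ (by positivity)
        linarith [lor_nonneg hl₂ (ξ - (-η₂))]
      · have := (h₂ (-ξ) (by linarith)).1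
        rw [← kk_neg, neg_neg, jb_neg, PP_neg, e1] at this
        refine this.trans ?_
        refine mul_le_mul_of_nonneg_left ?_ (by positivity)
        linarith [lor_nonneg hl₁ (ξ - η₁)]
    · rw [sum_three _ PP_integrable (lor_integrable hl₁ _) (lor_integrable hl₂ _),
        lor_integral hl₁, lor_integral hl₂, div_mul_eq_mul_div]
      refine div_le_div_of_nonneg_right ?_ (by positivity)
      linarith
  · refine ⟨fun ξ => 100 / t * ((lor (1 / t) (ξ - 0) + lor (1 / Y₁) (ξ - η₁)) + lor (1 / Y₂) (ξ - (-η₂))), ?_, ?_, ?_⟩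
    · exact (((lor_integrable it 0).add (lor_integrable i1 _)).add (lor_integrable i2 _)).const_mul _
    · intro ξ
      beta_reduce
      rw [sub_zero]
      rcases le_total 0 ξ with hξ | hξ
      · refine ((h₁ ξ hξ).2).trans ?_
        refine mul_le_mul_of_nonneg_left ?_ (by positivity)
        linarith [lor_nonneg i2 (ξ - (-η₂))]
      · have := (h₂ (-ξ) (by linarith)).2
        rw [← ww_neg, neg_neg, jb_neg, e2, e1] at this
        refine this.trans ?_
        refine mul_le_mul_of_nonneg_left ?_ (by positivity)
        linarith [lor_nonneg i1 (ξ - η₁)]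
    · rw [sum_three _ (lor_integrable it 0) (lor_integrable i1 _) (lor_integrable i2 _),
        lor_integral it, lor_integral i1, lor_integral i2, div_mul_eq_mul_div]
      refine div_le_div_of_nonneg_right ?_ (by positivity)
      linarith

lemma cutoff_sum (φ : ℝ → ℝ) (n : ℕ) (hn : 1 ≤ n) (ξ : ℝ) :
    ∑ l : Fin (n + 1), cutoff φ n (l : ℕ) ξ = 1 := by
  rw [Fin.sum_univ_eq_sum_range (fun l => cutoff φ n l ξ)]
  obtain ⟨m, rfl⟩ : ∃ m, n = m + 1 := ⟨n - 1, by omega⟩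
  rw [Finset.sum_range_succ, Finset.sum_range_succ']
  have h1 : ∀ j ∈ Finset.range m, cutoff φ (m + 1) (j + 1) ξ =
      φ (2 ^ (j + 101) * (|ξ| - Real.sqrt 3)) - φ (2 ^ (j + 1 + 101) * (|ξ| - Real.sqrt 3)) := by
    intro j hj
    have := Finset.mem_range.1 hj
    rw [cutoff, if_neg (by omega), if_neg (by omega)]
  rw [Finset.sum_congr rfl h1,
    Finset.sum_range_sub' (fun j => φ (2 ^ (j + 101) * (|ξ| - Real.sqrt 3)))]
  simp [cutoff]

/-- Set containing the support of the cutoff. -/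
def Eset (l : ℕ) : Set ℝ :=
  if l = 0 then Set.univ
  else Set.Icc (Real.sqrt 3 - 2 / 2 ^ (l + 100)) (Real.sqrt 3 + 2 / 2 ^ (l + 100)) ∪
    Set.Icc (-Real.sqrt 3 - 2 / 2 ^ (l + 100)) (-Real.sqrt 3 + 2 / 2 ^ (l + 100))

lemma Eset_meas (l : ℕ) : MeasurableSet (Eset l) := by
  unfold Eset
  split_ifs
  · exact MeasurableSet.univ
  · exact measurableSet_Icc.union measurableSet_Icc

lemma Eset_vol (l : ℕ) (hl : l ≠ 0) : volume (Eset l) ≤ ENNReal.ofReal ((1/2) ^ l) := by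
  unfold Eset
  rw [if_neg hl]
  refine (measure_union_le _ _).trans ?_
  rw [Real.volume_Icc, Real.volume_Icc]
  have h0 : (0:ℝ) < 2 / 2 ^ (l + 100) := by positivity
  rw [← ENNReal.ofReal_add (by linarith) (by linarith)]
  apply ENNReal.ofReal_le_ofReal
  have : (2:ℝ) / 2 ^ (l + 100) = (1/2) ^ l * (2 / 2 ^ 100) := by
    rw [pow_add, div_pow, one_pow]; field_simp
  ring_nf
  ring_nf at this
  have h3 : (0:ℝ) < (1/2)^l := by positivity
  nlinarith

lemma cutoff_supp (φ : ℝ → ℝ) (hφzero : ∀ x : ℝ, 2 ≤ |x| → φ x = 0) (n l : ℕ) (ξ : ℝ)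
    (h : ξ ∉ Eset l) : cutoff φ n l ξ = 0 := by
  unfold Eset at h
  split_ifs at h with hl
  · exact absurd (Set.mem_univ _) h
  have key : 2 / 2 ^ (l + 100) ≤ |(|ξ| - Real.sqrt 3)| := by
    by_contra hc
    push Not at hc
    apply h
    rw [abs_lt] at hc
    rcases le_total 0 ξ with h0 | h0
    · rw [abs_of_nonneg h0] at hc
      left; constructor <;> linarith
    · rw [abs_of_nonpos h0] at hc
      right; constructor <;> linarith
  have z : ∀ m : ℕ, l ≤ m → φ (2 ^ (m + 100) * (|ξ| - Real.sqrt 3)) = 0 := by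
    intro m hm
    apply hφzero
    rw [abs_mul, abs_of_pos (by positivity)]
    calc (2:ℝ) = 2 ^ (l + 100) * (2 / 2 ^ (l + 100)) := by field_simp
      _ ≤ 2 ^ (m + 100) * |(|ξ| - Real.sqrt 3)| := by gcongr; norm_num
  rw [cutoff, if_neg hl]
  split_ifs with hn
  · exact z n hn.le
  · rw [z l le_rfl]
    have := z (l + 1) (by omega)
    rw [show l + 101 = l + 1 + 100 by omega, this]; norm_num

lemma cutoff_abs_le (φ : ℝ → ℝ) (hφ0 : ∀ x, 0 ≤ φ x) (hφ1 : ∀ x, φ x ≤ 1) (n l : ℕ) (ξ : ℝ) :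
    |cutoff φ n l ξ| ≤ 1 := by
  unfold cutoff
  split_ifs <;> rw [abs_le]
  · constructor <;> linarith [hφ0 (2 ^ 101 * (|ξ| - Real.sqrt 3)), hφ1 (2 ^ 101 * (|ξ| - Real.sqrt 3))]
  · constructor <;> linarith [hφ0 (2 ^ (n + 100) * (|ξ| - Real.sqrt 3)), hφ1 (2 ^ (n + 100) * (|ξ| - Real.sqrt 3))]
  · constructor <;> linarith [hφ0 (2 ^ (l + 100) * (|ξ| - Real.sqrt 3)), hφ1 (2 ^ (l + 100) * (|ξ| - Real.sqrt 3)),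
      hφ0 (2 ^ (l + 101) * (|ξ| - Real.sqrt 3)), hφ1 (2 ^ (l + 101) * (|ξ| - Real.sqrt 3))]

lemma cutoff_cont (φ : ℝ → ℝ) (hc : Continuous φ) (n l : ℕ) : Continuous (cutoff φ n l) := by
  unfold cutoff
  split_ifs <;> fun_prop

/-- The seminorm part of `Bn`, for `p = ⟨ξ⟩² ∂ f̂`. -/
def Sn (φ : ℝ → ℝ) (n : ℕ) (p : ℝ → ℂ) : ℝ :=
  ⨆ l : Fin (n + 1), (2 : ℝ) ^ (-(((l : ℕ) : ℝ)) / 2) *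
        (∫ ξ : ℝ, ‖(cutoff φ n (l : ℕ) ξ : ℂ) * p ξ‖ ^ 2) ^ ((1 : ℝ) / 2)

lemma Sn_ge (φ : ℝ → ℝ) (n : ℕ) (p : ℝ → ℂ) (l : Fin (n + 1)) :
    (2 : ℝ) ^ (-(((l : ℕ) : ℝ)) / 2) *
        (∫ ξ : ℝ, ‖(cutoff φ n (l : ℕ) ξ : ℂ) * p ξ‖ ^ 2) ^ ((1 : ℝ) / 2) ≤ Sn φ n p :=
  le_ciSup (f := fun l : Fin (n + 1) => (2 : ℝ) ^ (-(((l : ℕ) : ℝ)) / 2) *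
        (∫ ξ : ℝ, ‖(cutoff φ n (l : ℕ) ξ : ℂ) * p ξ‖ ^ 2) ^ ((1 : ℝ) / 2))
    (Set.finite_range _).bddAbove l

lemma Sn_nonneg (φ : ℝ → ℝ) (n : ℕ) (p : ℝ → ℂ) : 0 ≤ Sn φ n p :=
  le_trans (by positivity) (Sn_ge φ n p 0)

/-- The weighted `L¹` bound. -/
lemma weighted_bound (φ : ℝ → ℝ) (hc : Continuous φ) (hφ0 : ∀ x, 0 ≤ φ x) (hφ1 : ∀ x, φ x ≤ 1)
    (hφzero : ∀ x : ℝ, 2 ≤ |x| → φ x = 0) (n : ℕ) (hn : 1 ≤ n) (p : SchwartzMap ℝ ℂ)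
    (W : ℝ → ℝ) (K : ℝ) (hW : Measurable W) (hW0 : ∀ ξ, 0 ≤ W ξ) (hWK : ∀ ξ, W ξ ≤ K)
    (hWi : Integrable (fun ξ => W ξ ^ 2)) (hWI : ∫ ξ, W ξ ^ 2 ≤ K ^ 2) :
    ∫ ξ, ‖p ξ‖ * W ξ ≤ (n + 1) * K * Sn φ n p := by
  have hK0 : 0 ≤ K := (hW0 0).trans (hWK 0)
  have hWL : MemLp W 2 volume := (memLp_two_iff_integrable_sq hW.aestronglyMeasurable).2 hWi
  have hp : MemLp p 2 volume := p.memLp 2 volume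
  let q : Fin (n + 1) → ℝ → ℝ := fun l ξ => ‖(cutoff φ n (l : ℕ) ξ : ℂ) * p ξ‖
  have hqc : ∀ l, Continuous (q l) := by
    intro l
    have := cutoff_cont φ hc n l
    have := p.continuous
    fun_prop
  have hq : ∀ l, MemLp (q l) 2 volume := by
    intro l
    refine hp.norm.mono (hqc l).aestronglyMeasurable (ae_of_all _ fun ξ => ?_)
    simp only [q, norm_mul, Complex.norm_real, Real.norm_eq_abs, abs_abs, abs_norm]
    nlinarith [cutoff_abs_le φ hφ0 hφ1 n l ξ, norm_nonneg (p ξ)]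
  have hqW : ∀ l, Integrable (fun ξ => q l ξ * W ξ) := fun l => (hq l).integrable_mul hWL
  have hpt : ∀ ξ, ‖p ξ‖ * W ξ ≤ ∑ l, q l ξ * W ξ := by
    intro ξ
    rw [← Finset.sum_mul]
    refine mul_le_mul_of_nonneg_right ?_ (hW0 ξ)
    calc ‖p ξ‖ = ‖∑ l : Fin (n + 1), (cutoff φ n (l : ℕ) ξ : ℂ) * p ξ‖ := by
          rw [← Finset.sum_mul, ← Complex.ofReal_sum, cutoff_sum φ n hn ξ]; simp
      _ ≤ _ := norm_sum_le _ _
  have hterm : ∀ l : Fin (n + 1), ∫ ξ, q l ξ * W ξ ≤ K * Sn φ n p := by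
    intro l
    let V : ℝ → ℝ := (Eset l).indicator W
    have hV0 : ∀ ξ, 0 ≤ V ξ := fun ξ => Set.indicator_nonneg (fun ξ _ => hW0 ξ) ξ
    have hVL : MemLp V 2 volume := hWL.indicator (Eset_meas l)
    have e : ∀ ξ, q l ξ * W ξ = q l ξ * V ξ := by
      intro ξ
      by_cases h : ξ ∈ Eset l
      · simp [V, h]
      · simp [q, cutoff_supp φ hφzero n l ξ h]
    have hVI : ∫ ξ, V ξ ^ 2 ≤ K ^ 2 * (1/2) ^ (l : ℕ) := by
      by_cases hl : (l : ℕ) = 0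
      · have : Eset l = Set.univ := by simp [Eset, hl]
        have e3 : V = W := by simp only [V, this, Set.indicator_univ]
        rw [e3, hl, pow_zero, mul_one]
        exact hWI
      · have hvol := Eset_vol l hl
        have e2 : ∀ ξ, V ξ ^ 2 = (Eset l).indicator (fun ξ => W ξ ^ 2) ξ := by
          intro ξ
          by_cases h : ξ ∈ Eset l <;> simp [V, h]
        simp_rw [e2]
        rw [integral_indicator (Eset_meas l)]
        have hfin : volume (Eset l) < ⊤ := hvol.trans_lt ENNReal.ofReal_lt_top
        calc ∫ ξ in Eset l, W ξ ^ 2 ≤ ∫ ξ in Eset l, K ^ 2 := by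
              apply setIntegral_mono_on hWi.integrableOn (integrableOn_const hfin.ne) (Eset_meas l)
              intro ξ _
              exact pow_le_pow_left₀ (hW0 ξ) (hWK ξ) 2
          _ = volume.real (Eset l) * K ^ 2 := by rw [setIntegral_const, smul_eq_mul]
          _ ≤ (1/2) ^ (l : ℕ) * K ^ 2 := by
              gcongr
              exact ENNReal.toReal_le_of_le_ofReal (by positivity) hvol
          _ = _ := by ring
    have hVI2 : (∫ ξ, V ξ ^ 2) ^ ((1:ℝ)/2) ≤ K * (2 : ℝ) ^ (-(((l : ℕ) : ℝ)) / 2) := by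
      calc (∫ ξ, V ξ ^ 2) ^ ((1:ℝ)/2) ≤ (K ^ 2 * (1/2) ^ (l : ℕ)) ^ ((1:ℝ)/2) := by
            apply Real.rpow_le_rpow _ hVI (by norm_num)
            exact integral_nonneg fun ξ => sq_nonneg _
        _ = K * (2 : ℝ) ^ (-(((l : ℕ) : ℝ)) / 2) := by
            rw [Real.mul_rpow (by positivity) (by positivity), ← Real.sqrt_eq_rpow,
              Real.sqrt_sq hK0, one_div, inv_pow, ← Real.rpow_natCast, ← Real.rpow_neg (by norm_num),
              ← Real.rpow_mul (by norm_num)]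
            congr 2
    calc ∫ ξ, q l ξ * W ξ = ∫ ξ, q l ξ * V ξ := by simp_rw [e]
      _ ≤ (∫ ξ, q l ξ ^ 2) ^ ((1:ℝ)/2) * (∫ ξ, V ξ ^ 2) ^ ((1:ℝ)/2) :=
          aux_CS _ _ (fun ξ => norm_nonneg _) hV0 (hq l) hVL
      _ ≤ (∫ ξ, q l ξ ^ 2) ^ ((1:ℝ)/2) * (K * (2 : ℝ) ^ (-(((l : ℕ) : ℝ)) / 2)) := by
          gcongr
      _ = K * ((2 : ℝ) ^ (-(((l : ℕ) : ℝ)) / 2) * (∫ ξ, q l ξ ^ 2) ^ ((1:ℝ)/2)) := by ring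
      _ ≤ _ := by
          gcongr
          exact Sn_ge φ n p l
  calc ∫ ξ, ‖p ξ‖ * W ξ ≤ ∫ ξ, ∑ l, q l ξ * W ξ :=
        integral_mono (hp.norm.integrable_mul hWL) (integrable_finsetSum _ fun l _ => hqW l) hpt
    _ = ∑ l, ∫ ξ, q l ξ * W ξ := integral_finsetSum _ fun l _ => hqW l
    _ ≤ ∑ l : Fin (n + 1), K * Sn φ n p := Finset.sum_le_sum fun l _ => hterm l
    _ = _ := by simp; ring

/-- The `L²` part of `Bn`. -/
def N0 (h : ℝ → ℂ) : ℝ := (∫ ξ : ℝ, ‖h ξ‖ ^ 2) ^ ((1 : ℝ) / 2)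

lemma N0_nonneg (h : ℝ → ℂ) : 0 ≤ N0 h := by unfold N0; positivity

/-- Sup bound for `h = ⟨ξ⟩² g`. -/
lemma sup_bound (φ : ℝ → ℝ) (hc : Continuous φ) (hφ0 : ∀ x, 0 ≤ φ x) (hφ1 : ∀ x, φ x ≤ 1)
    (hφzero : ∀ x : ℝ, 2 ≤ |x| → φ x = 0) (n : ℕ) (hn : 1 ≤ n) (g h p : SchwartzMap ℝ ℂ)
    (hh : ∀ ξ, h ξ = ((1 + ξ ^ 2 : ℝ) : ℂ) * g ξ)
    (hp : ∀ ξ, p ξ = ((1 + ξ ^ 2 : ℝ) : ℂ) * deriv g ξ) (ξ : ℝ) :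
    ‖h ξ‖ ≤ 4 * n * (N0 h + Sn φ n p) := by
  let W : ℝ → ℝ := (Set.Ioc ξ (ξ + 1)).indicator 1
  have hWm : Measurable W := measurable_one.indicator measurableSet_Ioc
  have hW0 : ∀ s, 0 ≤ W s := fun s => Set.indicator_nonneg (fun _ _ => zero_le_one) s
  have hW1 : ∀ s, W s ≤ 1 := fun s => Set.indicator_le_self' (fun _ _ => zero_le_one) s
  have hWsq : ∀ s, W s ^ 2 = W s := by
    intro s; by_cases hs : s ∈ Set.Ioc ξ (ξ + 1) <;> simp [W, hs]
  have hWi : Integrable W := by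
    rw [integrable_indicator_iff measurableSet_Ioc]
    exact integrableOn_const (by simp)
  have hWI : ∫ s, W s = 1 := by
    simp only [W]
    rw [integral_indicator measurableSet_Ioc]
    simp
  have hWi2 : Integrable (fun s => W s ^ 2) := by simpa only [hWsq] using hWi
  have hWI2 : ∫ s, W s ^ 2 = 1 := by simpa only [hWsq] using hWI
  have hb := weighted_bound φ hc hφ0 hφ1 hφzero n hn p W 1 hWm hW0 hW1 hWi2 (by rw [hWI2]; norm_num)
  have hWL : MemLp W 2 volume := (memLp_two_iff_integrable_sq hWm.aestronglyMeasurable).2 hWi2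
  have hcs := aux_CS (fun s => ‖h s‖) W (fun s => norm_nonneg _) hW0 (h.memLp 2 volume).norm hWL
  rw [hWI2, Real.one_rpow, mul_one] at hcs
  have hcs' : ∫ s, ‖h s‖ * W s ≤ N0 h := hcs
  -- derivative of h
  have hder : ∀ s, ‖deriv h s‖ ≤ ‖h s‖ + ‖p s‖ := by
    intro s
    have hd : HasDerivAt h (((2 * s : ℝ) : ℂ) * g s + ((1 + s ^ 2 : ℝ) : ℂ) * deriv g s) s := by
      have h1 : HasDerivAt (fun s : ℝ => ((1 + s ^ 2 : ℝ) : ℂ)) ((2 * s : ℝ) : ℂ) s := by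
        have : HasDerivAt (fun s : ℝ => 1 + s ^ 2) (2 * s) s := by
          simpa using (hasDerivAt_pow 2 s).const_add 1
        exact this.ofReal_comp
      have h2 := g.differentiableAt.hasDerivAt (x := s)
      have h3 := h1.mul h2
      have : (h : ℝ → ℂ) = (fun s : ℝ => ((1 + s ^ 2 : ℝ) : ℂ)) * g := by
        ext s; rw [hh]; rfl
      rw [this]; exact h3
    rw [hd.deriv, ← hp]
    refine (norm_add_le _ _).trans ?_
    gcongr
    rw [hh, norm_mul, norm_mul, Complex.norm_real, Complex.norm_real, Real.norm_eq_abs, Real.norm_eq_abs,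
      abs_of_pos (by positivity : 0 < 1 + s ^ 2)]
    gcongr
    rw [abs_le]; constructor <;> nlinarith [sq_nonneg (s - 1), sq_nonneg (s + 1)]
  obtain ⟨d, hd⟩ := aux_deriv_schwartz h
  have hdi : Integrable (fun s => ‖d s‖ * W s) := (d.memLp 2 volume).norm.integrable_mul hWL
  have hhi : Integrable (fun s => ‖h s‖ * W s) := (h.memLp 2 volume).norm.integrable_mul hWL
  have hpi : Integrable (fun s => ‖p s‖ * W s) := (p.memLp 2 volume).norm.integrable_mul hWL
  have hD : ∫ s, ‖d s‖ * W s ≤ N0 h + (n + 1) * 1 * Sn φ n p := by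
    calc ∫ s, ‖d s‖ * W s ≤ ∫ s, (‖h s‖ * W s + ‖p s‖ * W s) := by
          apply integral_mono hdi (hhi.add hpi)
          intro s
          simp only [hd, Pi.add_apply]
          nlinarith [mul_le_mul_of_nonneg_right (hder s) (hW0 s)]
      _ = _ := integral_add hhi hpi
      _ ≤ _ := add_le_add hcs' hb
  -- FTC
  have hftc : ∀ s ∈ Set.Ioc ξ (ξ + 1), ‖h ξ‖ ≤ ‖h s‖ + ∫ s, ‖d s‖ * W s := by
    intro s hs
    have h1 : ∫ r in ξ..s, d r = h s - h ξ := by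
      apply intervalIntegral.integral_eq_sub_of_hasDerivAt
      · intro r _
        rw [hd]
        exact h.differentiableAt.hasDerivAt
      · exact d.continuous.intervalIntegrable _ _
    have h2 : ‖∫ r in ξ..s, d r‖ ≤ ∫ s, ‖d s‖ * W s := by
      refine (intervalIntegral.norm_integral_le_integral_norm hs.1.le).trans ?_
      rw [intervalIntegral.integral_of_le hs.1.le, ← integral_indicator measurableSet_Ioc]
      apply integral_mono _ hdi
      · intro r
        by_cases hr : r ∈ Set.Ioc ξ s
        · have : r ∈ Set.Ioc ξ (ξ + 1) := ⟨hr.1, hr.2.trans hs.2⟩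
          simp [W, hr, this]
        · simp only [Set.indicator_of_notMem hr]
          exact mul_nonneg (norm_nonneg _) (hW0 r)
      · rw [integrable_indicator_iff measurableSet_Ioc]
        exact d.integrable.norm.integrableOn
    have h3 : h ξ = h s - ∫ r in ξ..s, d r := by rw [h1]; ring
    calc ‖h ξ‖ = ‖h s - ∫ r in ξ..s, d r‖ := by rw [← h3]
      _ ≤ ‖h s‖ + ‖∫ r in ξ..s, d r‖ := norm_sub_le _ _
      _ ≤ _ := by gcongr
  set I := ∫ s, ‖d s‖ * W s
  have hfin : ‖h ξ‖ ≤ N0 h + I := by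
    calc ‖h ξ‖ = ∫ s, ‖h ξ‖ * W s := by rw [integral_const_mul, hWI, mul_one]
      _ ≤ ∫ s, (‖h s‖ * W s + I * W s) := by
          apply integral_mono (hWi.const_mul _) (hhi.add (hWi.const_mul _))
          intro s
          by_cases hs : s ∈ Set.Ioc ξ (ξ + 1)
          · have := hftc s hs
            simpa [W, hs] using this
          · simp [W, hs]
      _ = (∫ s, ‖h s‖ * W s) + I := by
          rw [integral_add hhi (hWi.const_mul _), integral_const_mul, hWI, mul_one]
      _ ≤ _ := by gcongr
  have hn1 : (1:ℝ) ≤ n := by exact_mod_cast hn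
  have := N0_nonneg h
  have := Sn_nonneg φ n p
  nlinarith

/-- The oscillating factor. -/
def EE (x t ξ : ℝ) : ℂ := Complex.exp (Complex.I * ((x * ξ + t * Real.sqrt (1 + ξ ^ 2) : ℝ) : ℂ))

lemma EE_norm (x t ξ : ℝ) : ‖EE x t ξ‖ = 1 := by
  unfold EE; rw [mul_comm]; exact Complex.norm_exp_ofReal_mul_I _

lemma EE_deriv (x t ξ : ℝ) :
    HasDerivAt (EE x t) (EE x t ξ * (Complex.I * (phd x t ξ : ℂ))) ξ := by
  have h1 : HasDerivAt (fun ξ : ℝ => x * ξ + t * Real.sqrt (1 + ξ ^ 2)) (phd x t ξ) ξ := by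
    have h := ((hasDerivAt_id ξ).const_mul x).add ((hasDerivAt_jb ξ).const_mul t)
    refine HasDerivAt.congr_deriv (f := fun ξ : ℝ => x * ξ + t * Real.sqrt (1 + ξ ^ 2)) h ?_
    simp [phd]
  exact (h1.ofReal_comp.const_mul Complex.I).cexp

lemma osc_bound {t : ℝ} (ht : 1 ≤ t) (x : ℝ) (g h p : SchwartzMap ℝ ℂ)
    (hh : ∀ ξ, h ξ = ((1 + ξ ^ 2 : ℝ) : ℂ) * g ξ)
    (hp : ∀ ξ, p ξ = ((1 + ξ ^ 2 : ℝ) : ℂ) * deriv g ξ)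
    (G : ℝ) (hG : ∀ ξ, ‖h ξ‖ ≤ G) (H : ℝ → ℝ) (hH : Integrable H)
    (hkH : ∀ ξ, kk x t ξ / jb ξ ^ 2 ≤ H ξ)
    (hW : Integrable (fun ξ => ‖p ξ‖ * (|ww x t ξ| / jb ξ ^ 2))) :
    ‖∫ ξ, EE x t ξ * g ξ‖ ≤ 4 * G * (∫ ξ, H ξ) + ∫ ξ, ‖p ξ‖ * (|ww x t ξ| / jb ξ ^ 2) := by
  have ht0 : 0 ≤ t := by linarith
  choose w' hw' hw'b using fun ξ => hasDerivAt_ww ht0 x ξ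
  have hnh : ∀ ξ, ‖h ξ‖ = jb ξ ^ 2 * ‖g ξ‖ := by
    intro ξ
    rw [hh, norm_mul, Complex.norm_real, Real.norm_eq_abs, abs_of_pos (by positivity), jb_sq]
  have hnp : ∀ ξ, ‖p ξ‖ = jb ξ ^ 2 * ‖deriv g ξ‖ := by
    intro ξ
    rw [hp, norm_mul, Complex.norm_real, Real.norm_eq_abs, abs_of_pos (by positivity), jb_sq]
  let F : ℝ → ℂ := fun ξ => EE x t ξ * ((ww x t ξ : ℂ) * g ξ)
  let F' : ℝ → ℂ := fun ξ => EE x t ξ * (Complex.I * (phd x t ξ : ℂ)) * ((ww x t ξ : ℂ) * g ξ) +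
    EE x t ξ * ((w' ξ : ℂ) * g ξ + (ww x t ξ : ℂ) * deriv g ξ)
  have hF : ∀ ξ, HasDerivAt F (F' ξ) ξ := by
    intro ξ
    exact (EE_deriv x t ξ).mul ((hw' ξ).ofReal_comp.mul g.differentiableAt.hasDerivAt)
  let R : ℝ → ℂ := fun ξ => (kk x t ξ : ℂ) * (EE x t ξ * g ξ) +
    Complex.I * (EE x t ξ * ((w' ξ : ℂ) * g ξ + (ww x t ξ : ℂ) * deriv g ξ))
  have hkw : ∀ ξ, phd x t ξ * ww x t ξ = 1 - kk x t ξ := by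
    intro ξ
    have hM := MM_pos ht0 ξ
    have hD : 0 < phd x t ξ ^ 2 + MM t ξ := by positivity
    unfold ww kk
    field_simp
    ring
  have hR : ∀ ξ, R ξ = EE x t ξ * g ξ + Complex.I * F' ξ := by
    intro ξ
    have : (phd x t ξ : ℂ) * (ww x t ξ : ℂ) = 1 - (kk x t ξ : ℂ) := by
      exact_mod_cast hkw ξ
    simp only [R, F']
    linear_combination (EE x t ξ * g ξ) * this -
      (EE x t ξ * g ξ * (phd x t ξ : ℂ) * (ww x t ξ : ℂ)) * Complex.I_mul_I
  have hRb : ∀ ξ, ‖R ξ‖ ≤ 4 * (kk x t ξ * ‖g ξ‖) + |ww x t ξ| * ‖deriv g ξ‖ := by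
    intro ξ
    have hk0 := kk_nonneg ht0 x ξ
    simp only [R]
    refine (norm_add_le _ _).trans ?_
    rw [norm_mul, norm_mul, norm_mul, norm_mul, EE_norm, Complex.norm_I, Complex.norm_real,
      Real.norm_eq_abs, abs_of_nonneg hk0]
    have h1 : ‖(w' ξ : ℂ) * g ξ + (ww x t ξ : ℂ) * deriv g ξ‖ ≤
        3 * kk x t ξ * ‖g ξ‖ + |ww x t ξ| * ‖deriv g ξ‖ := by
      refine (norm_add_le _ _).trans ?_
      rw [norm_mul, norm_mul, Complex.norm_real, Complex.norm_real, Real.norm_eq_abs, Real.norm_eq_abs]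
      gcongr
      exact hw'b ξ
    linarith
  have hwle : ∀ ξ, |ww x t ξ| ≤ jb ξ ^ 2 := by
    intro ξ
    have hX := jb_pos ξ
    have h1 := (ww_sup ht x ξ).trans (div_le_one_of_le₀ ht ht0)
    rw [div_le_one (by positivity)] at h1
    apply abs_le_of_sq_le_sq _ (by positivity)
    calc _ ≤ _ := h1
      _ = _ := by ring
  have hEg : Integrable (fun ξ => EE x t ξ * g ξ) := by
    refine g.integrable.norm.mono' ?_ (ae_of_all _ fun ξ => ?_)
    · have hc : Continuous (EE x t) := continuous_iff_continuousAt.2 fun ξ => (EE_deriv x t ξ).continuousAt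
      exact (hc.mul g.continuous).aestronglyMeasurable
    · rw [norm_mul, EE_norm, one_mul]
  have hFi : Integrable F := by
    refine h.integrable.norm.mono' ?_ (ae_of_all _ fun ξ => ?_)
    · have hc : Continuous F := continuous_iff_continuousAt.2 fun ξ => (hF ξ).continuousAt
      exact hc.aestronglyMeasurable
    · simp only [F]
      rw [norm_mul, EE_norm, one_mul, norm_mul, Complex.norm_real, Real.norm_eq_abs, hnh]
      gcongr
      exact hwle ξ
  have hF'i : Integrable F' := by
    refine ((g.integrable.norm.const_mul 5).add p.integrable.norm).mono' ?_ (ae_of_all _ fun ξ => ?_)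
    · have : F' = deriv F := by ext ξ; exact (hF ξ).deriv.symm
      rw [this]
      exact (measurable_deriv F).aestronglyMeasurable
    · have e : F' ξ = Complex.I * (EE x t ξ * g ξ - R ξ) := by
        rw [hR]; linear_combination (F' ξ) * Complex.I_mul_I
      rw [e, norm_mul, Complex.norm_I, one_mul]
      refine (norm_sub_le _ _).trans ?_
      rw [norm_mul, EE_norm, one_mul, Pi.add_apply]
      have h1 := hRb ξ
      have h2 : kk x t ξ * ‖g ξ‖ ≤ 1 * ‖g ξ‖ := by gcongr; exact kk_le_one ht0 x ξ
      have h3 : |ww x t ξ| * ‖deriv g ξ‖ ≤ ‖p ξ‖ := by rw [hnp]; gcongr; exact hwle ξ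
      linarith
  have hzero : ∫ ξ, F' ξ = 0 := integral_eq_zero_of_hasDerivAt_of_integrable hF hF'i hFi
  have hIntEq : ∫ ξ, EE x t ξ * g ξ = ∫ ξ, R ξ := by
    simp_rw [hR]
    rw [integral_add hEg (hF'i.const_mul _), integral_const_mul, hzero]; simp
  rw [hIntEq, ← integral_const_mul, ← integral_add (hH.const_mul _) hW]
  refine norm_integral_le_of_norm_le ((hH.const_mul _).add hW) (ae_of_all _ fun ξ => ?_)
  refine (hRb ξ).trans ?_
  have hX := jb_pos ξ
  have h1 : |ww x t ξ| * ‖deriv g ξ‖ = ‖p ξ‖ * (|ww x t ξ| / jb ξ ^ 2) := by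
    rw [hnp]; field_simp
  have h2 : kk x t ξ * ‖g ξ‖ ≤ G * H ξ := by
    have hk0 := kk_nonneg ht0 x ξ
    have hG0 : 0 ≤ G := (norm_nonneg _).trans (hG ξ)
    calc kk x t ξ * ‖g ξ‖ = ‖h ξ‖ * (kk x t ξ / jb ξ ^ 2) := by rw [hnh]; field_simp
      _ ≤ G * H ξ := by
        gcongr
        · exact hG ξ
        · exact hkH ξ
  rw [h1]
  linarith

lemma ww_cont {t : ℝ} (ht : 0 ≤ t) (x : ℝ) : Continuous (ww x t) :=
  continuous_iff_continuousAt.2 fun ξ => by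
    obtain ⟨w', h, _⟩ := hasDerivAt_ww ht x ξ
    exact h.continuousAt

lemma jb_cont : Continuous jb :=
  continuous_iff_continuousAt.2 fun ξ => (hasDerivAt_jb ξ).continuousAt

/-- Dispersive decay estimate for the half Klein–Gordon propagator in the adapted
functional framework. -/
theorem dispersive_decay_estimate (φ : ℝ → ℝ) (hφsmooth : ContDiff ℝ (⊤ : ℕ∞) φ)
    (hφeven : ∀ x, φ (-x) = φ x) (hφ0 : ∀ x, 0 ≤ φ x) (hφ1 : ∀ x, φ x ≤ 1)
    (hφone : ∀ x : ℝ, |x| ≤ 1 → φ x = 1) (hφzero : ∀ x : ℝ, 2 ≤ |x| → φ x = 0) :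
    ∃ C : ℝ, 1 ≤ C ∧
      ∀ n : ℕ, 1 ≤ n → ∀ f : SchwartzMap ℝ ℂ, ∀ t : ℝ, 0 ≤ t → ∀ x : ℝ,
        ‖propagator t (⇑f) x‖ ≤
          C * ((n : ℝ) / (1 + t ^ 2) ^ ((1 : ℝ) / 4)) * Bn φ n (⇑f) := by
  obtain ⟨C, hC1, hC⟩ := full_bound
  have hcont : Continuous φ := hφsmooth.continuous
  refine ⟨36 * C, by linarith, fun n hn f t ht x => ?_⟩
  obtain ⟨g, hg⟩ := aux_FT_schwartz f
  obtain ⟨g', hg'⟩ := aux_deriv_schwartz g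
  obtain ⟨h, hh⟩ := aux_mul_schwartz g
  obtain ⟨p, hp⟩ := aux_mul_schwartz g'
  simp_rw [hg'] at hp
  have hFT : FT (⇑f) = g := by ext ξ; exact (hg ξ).symm
  have hB : Bn φ n f = N0 h + Sn φ n p := by
    unfold Bn N0 Sn
    rw [hFT]
    simp_rw [hh, hp, mul_assoc]
  have hN0 := N0_nonneg h
  have hS0 := Sn_nonneg φ n p
  have hn1 : (1:ℝ) ≤ n := by exact_mod_cast hn
  have hsup := sup_bound φ hcont hφ0 hφ1 hφzero n hn g h p hh hp
  set B := N0 h + Sn φ n p with hBdef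
  have hB0 : 0 ≤ B := by positivity
  -- reduce to the oscillatory integral
  have hprop : ‖propagator t f x‖ ≤ ‖∫ ξ, EE x t ξ * g ξ‖ := by
    unfold propagator
    rw [hFT, norm_mul, norm_inv, Complex.norm_real, Real.norm_eq_abs, abs_of_nonneg (Real.sqrt_nonneg _)]
    have h1 : 1 ≤ Real.sqrt (2 * Real.pi) := by
      rw [Real.one_le_sqrt]; linarith [Real.pi_gt_three]
    have h2 : (Real.sqrt (2 * Real.pi))⁻¹ ≤ 1 := inv_le_one_of_one_le₀ h1
    exact mul_le_of_le_one_left (norm_nonneg _) h2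
  refine hprop.trans ?_
  rw [hB]
  have hb0 : 0 < (1 + t ^ 2) ^ ((1:ℝ)/4) := by positivity
  rcases le_total 1 t with ht1 | ht1
  · have ht0 : 0 < t := by linarith
    have hst : 0 < Real.sqrt t := Real.sqrt_pos.2 ht0
    obtain ⟨⟨H, hHi, hkH, hHI⟩, ⟨H₂, hH₂i, hwH, hH₂I⟩⟩ := hC t ht1 x
    let W : ℝ → ℝ := fun ξ => |ww x t ξ| / jb ξ ^ 2
    have hWc : Continuous W :=
      (ww_cont ht x).abs.div (jb_cont.pow 2) fun ξ => (pow_pos (jb_pos ξ) 2).ne'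
    have hW0 : ∀ ξ, 0 ≤ W ξ := fun ξ => by have := jb_pos ξ; positivity
    have hWsq : ∀ ξ, W ξ ^ 2 = ww x t ξ ^ 2 / jb ξ ^ 4 := by
      intro ξ; simp only [W]; rw [div_pow, sq_abs]; ring
    have hK2 : Real.sqrt (C / t) ^ 2 = C / t := Real.sq_sqrt (by positivity)
    have hWK : ∀ ξ, W ξ ≤ Real.sqrt (C / t) := by
      intro ξ
      apply Real.le_sqrt_of_sq_le
      rw [hWsq]
      refine (ww_sup ht1 x ξ).trans ?_
      gcongr
    have hWi : Integrable (fun ξ => W ξ ^ 2) := by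
      refine hH₂i.mono' (hWc.pow 2).aestronglyMeasurable (ae_of_all _ fun ξ => ?_)
      rw [Real.norm_eq_abs, abs_of_nonneg (sq_nonneg _), hWsq]
      exact hwH ξ
    have hWI : ∫ ξ, W ξ ^ 2 ≤ Real.sqrt (C / t) ^ 2 := by
      rw [hK2]
      refine le_trans (integral_mono hWi hH₂i fun ξ => ?_) hH₂I
      simp only [hWsq]
      exact hwH ξ
    have hWL : MemLp W 2 volume :=
      (memLp_two_iff_integrable_sq hWc.aestronglyMeasurable).2 hWi
    have hpW : Integrable (fun ξ => ‖p ξ‖ * W ξ) := (p.memLp 2 volume).norm.integrable_mul hWL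
    have hwb := weighted_bound φ hcont hφ0 hφ1 hφzero n hn p W _ hWc.measurable hW0 hWK hWi hWI
    have hosc := osc_bound ht1 x g h p hh hp _ hsup H hHi hkH hpW
    have hKle : Real.sqrt (C / t) ≤ C / Real.sqrt t := by
      rw [Real.sqrt_div (by linarith)]
      gcongr
      rw [Real.sqrt_le_left (by linarith)]
      nlinarith
    have hq : (1 + t ^ 2) ^ ((1:ℝ)/4) ≤ 2 * Real.sqrt t := by
      have h1 : (2 * Real.sqrt t) = ((2 * Real.sqrt t) ^ 4) ^ ((1:ℝ)/4) := by
        rw [← Real.rpow_natCast, ← Real.rpow_mul (by positivity)]; norm_num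
      rw [h1]
      apply Real.rpow_le_rpow (by positivity) _ (by norm_num)
      have h2 : (2 * Real.sqrt t) ^ 4 = 16 * t ^ 2 := by
        rw [mul_pow, show Real.sqrt t ^ 4 = (Real.sqrt t ^ 2) ^ 2 by ring, Real.sq_sqrt ht]; norm_num
      rw [h2]; nlinarith
    have hSB : Sn φ n p ≤ B := by linarith
    calc ‖∫ ξ, EE x t ξ * g ξ‖ ≤ 4 * (4 * n * B) * (∫ ξ, H ξ) + ∫ ξ, ‖p ξ‖ * W ξ := hosc
      _ ≤ 4 * (4 * n * B) * (C / Real.sqrt t) + (n + 1) * Real.sqrt (C / t) * Sn φ n p := by gcongr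
      _ ≤ 4 * (4 * n * B) * (C / Real.sqrt t) + (n + n) * (C / Real.sqrt t) * B := by gcongr
      _ = 36 * C * (n / (2 * Real.sqrt t)) * B := by field_simp; ring
      _ ≤ 36 * C * (n / (1 + t ^ 2) ^ ((1:ℝ)/4)) * B := by gcongr
  · have hq : (1 + t ^ 2) ^ ((1:ℝ)/4) ≤ 2 := by
      calc (1 + t ^ 2) ^ ((1:ℝ)/4) ≤ (1 + t ^ 2) ^ (1:ℝ) := by
            apply Real.rpow_le_rpow_of_exponent_le <;> nlinarith
        _ ≤ 2 := by rw [Real.rpow_one]; nlinarith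
    have hpi := Real.pi_lt_four
    calc ‖∫ ξ, EE x t ξ * g ξ‖ ≤ ∫ ξ, (4 * n * B) * (1 + ξ ^ 2)⁻¹ := by
          refine norm_integral_le_of_norm_le (integrable_inv_one_add_sq.const_mul _)
            (ae_of_all _ fun ξ => ?_)
          rw [norm_mul, EE_norm, one_mul, ← div_eq_mul_inv, le_div_iff₀ (by positivity)]
          refine le_trans (le_of_eq ?_) (hsup ξ)
          rw [hh, norm_mul, Complex.norm_real, Real.norm_eq_abs, abs_of_pos (by positivity), mul_comm]
      _ = (4 * n * B) * Real.pi := by rw [integral_const_mul, integral_univ_inv_one_add_sq]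
      _ ≤ (4 * n * B) * 4 := by gcongr
      _ ≤ 36 * 1 * (n / 2) * B := by nlinarith [mul_nonneg (by linarith : (0:ℝ) ≤ n) hB0]
      _ ≤ 36 * C * (n / (1 + t ^ 2) ^ ((1:ℝ)/4)) * B := by gcongr
end
end

section
/- Fix an even φ ∈ C_c^∞(ℝ), 0 ≤ φ ≤ 1, with φ(x) = 1 for |x| ≤ 1 and φ(x) = 0 for |x| ≥ 2, and define ψ, φ_k, the projections P_k and the cutoffs φ_ℓ⁽ⁿ⁾ from φ as in the context. Then there exists a constant C ≥ 1 (depending only on φ) such that for every integer n ≥ 1, every integer k ≥ 0, every Schwartz function f, and every t ≥ 1, ‖e^{it⟨D⟩} P_k f‖_{L^∞(ℝ)} ≤ C (2^{−k/2} n / t^{1/2}) · B_n(f), where B_n(f) := ‖⟨ξ⟩² f̂(ξ)‖_{L²_ξ} + max_{0 ≤ ℓ ≤ n} 2^{−ℓ/2} ‖φ_ℓ⁽ⁿ⁾(ξ) ⟨ξ⟩² ∂_ξ f̂(ξ)‖_{L²_ξ}. -/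
open MeasureTheory Filter Topology

noncomputable section

/-- The Littlewood–Paley symbol `ψ(2^{-k}ξ)` of `P_k`, where `ψ(x) = φ(x) − φ(2x)`. -/
def lpSymb (φ : ℝ → ℝ) (k : ℕ) (ξ : ℝ) : ℝ :=
  φ (((2 : ℝ) ^ k)⁻¹ * ξ) - φ (2 * (((2 : ℝ) ^ k)⁻¹ * ξ))

/-- `(e^{it⟨D⟩}P_k f)(x) = (2π)^{-1/2} ∫ e^{ixξ} e^{it⟨ξ⟩} ψ(2^{-k}ξ) f̂(ξ) dξ`. -/
def propagatorPk (φ : ℝ → ℝ) (k : ℕ) (t : ℝ) (f : ℝ → ℂ) (x : ℝ) : ℂ :=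
  (Real.sqrt (2 * Real.pi) : ℂ)⁻¹ *
    ∫ ξ : ℝ, Complex.exp (Complex.I * ((x * ξ + t * Real.sqrt (1 + ξ ^ 2) : ℝ) : ℂ)) *
      (lpSymb φ k ξ : ℂ) * FT f ξ

theorem aux_CS_s13 {α : Type*} [MeasurableSpace α] (μ : Measure α) (f g : α → ℝ) (hf0 : ∀ x, 0 ≤ f x)
    (hg0 : ∀ x, 0 ≤ g x) (hf : MemLp f 2 μ) (hg : MemLp g 2 μ) :
    ∫ x, f x * g x ∂μ ≤ √(∫ x, f x ^ 2 ∂μ) * √(∫ x, g x ^ 2 ∂μ) := by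
  have := integral_mul_le_Lp_mul_Lq_of_nonneg (μ := μ) (p := 2) (q := 2) (f := f) (g := g)
    (by constructor <;> norm_num)
    (Eventually.of_forall hf0) (Eventually.of_forall hg0) (by simpa using hf) (by simpa using hg)
  simpa [Real.sqrt_eq_rpow] using this

theorem aux_CS_int (a b : ℝ) (hab : a ≤ b) (f g : ℝ → ℝ) (hf0 : ∀ x, 0 ≤ f x)
    (hg0 : ∀ x, 0 ≤ g x) (hf : Continuous f) (hg : Continuous g) :
    ∫ x in a..b, f x * g x ≤ √(∫ x in a..b, f x ^ 2) * √(∫ x in a..b, g x ^ 2) := by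
  simp only [intervalIntegral.integral_of_le hab]
  have key : ∀ f : ℝ → ℝ, Continuous f → MemLp f 2 (volume.restrict (Set.Ioc a b)) := by
    intro f hf
    rw [memLp_two_iff_integrable_sq hf.aestronglyMeasurable]
    exact ((hf.pow 2).integrableOn_Icc).mono_set Set.Ioc_subset_Icc_self
  exact aux_CS_s13 _ f g hf0 hg0 (key f hf) (key g hg)

/-- integration by parts without stationary points -/
theorem aux_ibp (Φ p d : ℝ → ℝ) (h h' : ℝ → ℂ) (R μ : ℝ) (hR : 0 < R) (hμ : 0 < μ)
    (hΦ : ∀ x, HasDerivAt Φ (p x) x) (hp : ∀ x, HasDerivAt p (d x) x) (hd : Continuous d)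
    (hd0 : ∀ x, 0 ≤ d x)
    (hh : ∀ x, HasDerivAt h (h' x) x) (hh' : Continuous h') (h1 : h (-R) = 0) (h2 : h R = 0) :
    ‖∫ x in (-R)..R, Complex.exp (Complex.I * (Φ x : ℂ)) * h x‖ ≤
      (∫ x in (-R)..R, ‖h x‖ * (μ ^ 2 / (p x ^ 2 + μ ^ 2))) +
      (∫ x in (-R)..R, ‖h' x‖ * (|p x| / (p x ^ 2 + μ ^ 2))) +
      (∫ x in (-R)..R, ‖h x‖ * (d x / (p x ^ 2 + μ ^ 2))) := by
  have hRR : -R ≤ R := by linarith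
  have cΦ : Continuous Φ := continuous_iff_continuousAt.2 fun x => (hΦ x).continuousAt
  have cp : Continuous p := continuous_iff_continuousAt.2 fun x => (hp x).continuousAt
  have ch : Continuous h := continuous_iff_continuousAt.2 fun x => (hh x).continuousAt
  have hpos : ∀ x, 0 < p x ^ 2 + μ ^ 2 := fun x => by positivity
  have hne : ∀ x, p x ^ 2 + μ ^ 2 ≠ 0 := fun x => (hpos x).ne'
  set q : ℝ → ℝ := fun x => p x / (p x ^ 2 + μ ^ 2) with hq
  set q' : ℝ → ℝ := fun x => d x * (μ ^ 2 - p x ^ 2) / (p x ^ 2 + μ ^ 2) ^ 2 with hq'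
  have dq : ∀ x, HasDerivAt q (q' x) x := by
    intro x
    have := (hp x).div (((hp x).pow 2).add_const (μ ^ 2)) (hne x)
    refine this.congr_deriv ?_
    simp only [hq']
    congr 1
    simp; ring
  have cq : Continuous q := continuous_iff_continuousAt.2 fun x => (dq x).continuousAt
  have cq' : Continuous q' := by
    refine Continuous.div (by fun_prop) (by fun_prop) fun x => pow_ne_zero _ (hne x)
  set E : ℝ → ℂ := fun x => Complex.exp (Complex.I * (Φ x : ℂ)) with hE
  have cE : Continuous E := by fun_prop
  have nE : ∀ x, ‖E x‖ = 1 := by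
    intro x; simp only [hE]; rw [mul_comm]; exact Complex.norm_exp_ofReal_mul_I _
  have dE : ∀ x, HasDerivAt E (E x * (Complex.I * (p x : ℂ))) x := by
    intro x
    exact (((hΦ x).ofReal_comp).const_mul Complex.I).cexp
  have dW : ∀ x, HasDerivAt (fun x => E x * (q x : ℂ) * h x)
      (E x * (Complex.I * (p x : ℂ)) * (q x : ℂ) * h x + E x * (q' x : ℂ) * h x
        + E x * (q x : ℂ) * h' x) x := by
    intro x
    refine (((dE x).mul ((dq x).ofReal_comp)).mul (hh x)).congr_deriv ?_
    simp only [Pi.mul_apply]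
    ring
  have ftc := intervalIntegral.integral_eq_sub_of_hasDerivAt (a := -R) (b := R) (fun x _ => dW x)
    (Continuous.intervalIntegrable (by fun_prop) _ _)
  rw [h1, h2] at ftc
  simp only [mul_zero, sub_zero] at ftc
  -- pointwise decomposition
  have dec : ∀ x, E x * h x = E x * ((μ ^ 2 / (p x ^ 2 + μ ^ 2) : ℝ) : ℂ) * h x
      + Complex.I * (E x * (q' x : ℂ) * h x) + Complex.I * (E x * (q x : ℂ) * h' x)
      + (-Complex.I) * (E x * (Complex.I * (p x : ℂ)) * (q x : ℂ) * h x + E x * (q' x : ℂ) * h x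
        + E x * (q x : ℂ) * h' x) := by
    intro x
    have e1 : ((μ ^ 2 / (p x ^ 2 + μ ^ 2) : ℝ) : ℂ) + (p x : ℂ) * (q x : ℂ) = 1 := by
      rw [← Complex.ofReal_mul, ← Complex.ofReal_add]
      have : μ ^ 2 / (p x ^ 2 + μ ^ 2) + p x * q x = 1 := by
        simp only [hq]; field_simp [hne x]; ring
      rw [this]; simp
    linear_combination (-(E x * h x)) * e1 + (E x * (p x : ℂ) * (q x : ℂ) * h x) * Complex.I_sq
  have cm : Continuous fun x => μ ^ 2 / (p x ^ 2 + μ ^ 2) :=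
    Continuous.div (by fun_prop) (by fun_prop) hne
  have ii : ∀ F : ℝ → ℂ, Continuous F → IntervalIntegrable F volume (-R) R :=
    fun F hF => hF.intervalIntegrable _ _
  have eq1 : ∫ x in (-R)..R, E x * h x =
      (∫ x in (-R)..R, E x * ((μ ^ 2 / (p x ^ 2 + μ ^ 2) : ℝ) : ℂ) * h x)
      + (∫ x in (-R)..R, Complex.I * (E x * (q' x : ℂ) * h x))
      + ∫ x in (-R)..R, Complex.I * (E x * (q x : ℂ) * h' x) := by
    rw [intervalIntegral.integral_congr (g := _) (fun x _ => dec x)]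
    rw [intervalIntegral.integral_add (ii _ (by fun_prop)) (ii _ (by fun_prop)),
      intervalIntegral.integral_add (ii _ (by fun_prop)) (ii _ (by fun_prop)),
      intervalIntegral.integral_add (ii _ (by fun_prop)) (ii _ (by fun_prop)),
      intervalIntegral.integral_const_mul (-Complex.I), ftc]
    simp
  have bd : ∀ (F : ℝ → ℂ) (G : ℝ → ℝ), Continuous G → (∀ x, ‖F x‖ ≤ G x) →
      ‖∫ x in (-R)..R, F x‖ ≤ ∫ x in (-R)..R, G x := by
    intro F G hG hFG
    exact intervalIntegral.norm_integral_le_of_norm_le hRR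
      (Eventually.of_forall fun x _ => hFG x) (hG.intervalIntegrable _ _)
  rw [eq1]
  have b1 := bd (fun x => E x * ((μ ^ 2 / (p x ^ 2 + μ ^ 2) : ℝ) : ℂ) * h x)
    (fun x => ‖h x‖ * (μ ^ 2 / (p x ^ 2 + μ ^ 2))) (by fun_prop) (by
      intro x
      rw [norm_mul, norm_mul, nE, one_mul, Complex.norm_real, Real.norm_of_nonneg
        (by have := hpos x; positivity), mul_comm])
  have b2 := bd (fun x => Complex.I * (E x * (q' x : ℂ) * h x))
    (fun x => ‖h x‖ * (d x / (p x ^ 2 + μ ^ 2)))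
    (ch.norm.mul (Continuous.div (by fun_prop) (by fun_prop) hne)) (by
      intro x
      rw [norm_mul, norm_mul, norm_mul, nE, one_mul, Complex.norm_I, one_mul, Complex.norm_real,
        mul_comm]
      refine mul_le_mul_of_nonneg_left ?_ (norm_nonneg _)
      simp only [hq', Real.norm_eq_abs, abs_div, abs_mul, abs_of_nonneg (hd0 x)]
      rw [abs_of_pos (pow_pos (hpos x) 2), div_le_div_iff₀ (pow_pos (hpos x) 2) (hpos x)]
      have : |μ ^ 2 - p x ^ 2| ≤ p x ^ 2 + μ ^ 2 := by
        rw [abs_le]; constructor <;> nlinarith [sq_nonneg (p x), sq_nonneg μ]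
      have h3 := mul_le_mul_of_nonneg_left this (mul_nonneg (hd0 x) (hpos x).le)
      nlinarith)
  have b3 := bd (fun x => Complex.I * (E x * (q x : ℂ) * h' x))
    (fun x => ‖h' x‖ * (|p x| / (p x ^ 2 + μ ^ 2)))
    (hh'.norm.mul (Continuous.div (by fun_prop) (by fun_prop) hne)) (by
      intro x
      rw [norm_mul, norm_mul, norm_mul, nE, one_mul, Complex.norm_I, one_mul, Complex.norm_real,
        mul_comm]
      simp only [hq, Real.norm_eq_abs, abs_div, abs_of_pos (hpos x)]
      exact le_rfl)
  refine (norm_add_le _ _).trans ?_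
  have := norm_add_le (∫ x in (-R)..R, E x * ((μ ^ 2 / (p x ^ 2 + μ ^ 2) : ℝ) : ℂ) * h x)
    (∫ x in (-R)..R, Complex.I * (E x * (q' x : ℂ) * h x))
  linarith

theorem aux_arctan (p d : ℝ → ℝ) (R μ : ℝ) (hμ : 0 < μ)
    (hp : ∀ x, HasDerivAt p (d x) x) (hd : Continuous d) :
    ∫ x in (-R)..R, d x / (p x ^ 2 + μ ^ 2) ≤ Real.pi / μ := by
  have cp : Continuous p := continuous_iff_continuousAt.2 fun x => (hp x).continuousAt
  have hne : ∀ x, p x ^ 2 + μ ^ 2 ≠ 0 := fun x => by positivity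
  have dA : ∀ x, HasDerivAt (fun x => Real.arctan (p x / μ) / μ) (d x / (p x ^ 2 + μ ^ 2)) x := by
    intro x
    refine ((((hp x).div_const μ).arctan).div_const μ).congr_deriv ?_
    have := hne x
    have h3 : 1 + (p x / μ) ^ 2 ≠ 0 := by positivity
    field_simp
    ring
  rw [intervalIntegral.integral_eq_sub_of_hasDerivAt (fun x _ => dA x)
    ((Continuous.div hd (by fun_prop) hne).intervalIntegrable _ _), ← sub_div]
  gcongr
  have := Real.arctan_lt_pi_div_two (p R / μ)
  have := Real.neg_pi_div_two_lt_arctan (p (-R) / μ)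
  linarith

theorem aux_arctan2 (p d : ℝ → ℝ) (R μ lam : ℝ) (hR : 0 < R) (hμ : 0 < μ) (hl : 0 < lam)
    (hp : ∀ x, HasDerivAt p (d x) x) (hd : Continuous d)
    (hdl : ∀ x, |x| ≤ R → lam ≤ d x) :
    ∫ x in (-R)..R, 1 / (p x ^ 2 + μ ^ 2) ≤ Real.pi / (lam * μ) := by
  have cp : Continuous p := continuous_iff_continuousAt.2 fun x => (hp x).continuousAt
  have hpos : ∀ x, 0 < p x ^ 2 + μ ^ 2 := fun x => by positivity
  have hne : ∀ x, p x ^ 2 + μ ^ 2 ≠ 0 := fun x => (hpos x).ne'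
  have := aux_arctan p d R μ hμ hp hd
  have h2 : ∫ x in (-R)..R, 1 / (p x ^ 2 + μ ^ 2) ≤
      ∫ x in (-R)..R, lam⁻¹ * (d x / (p x ^ 2 + μ ^ 2)) := by
    apply intervalIntegral.integral_mono_on (by linarith)
    · exact (Continuous.div continuous_const (by fun_prop) hne).intervalIntegrable _ _
    · exact (continuous_const.mul (Continuous.div hd (by fun_prop) hne)).intervalIntegrable _ _
    · intro x hx
      have hx' := hdl x (abs_le.2 hx)
      rw [← mul_div_assoc]
      apply div_le_div_of_nonneg_right _ (hpos x).le
      rw [inv_mul_eq_div, le_div_iff₀ hl]; linarith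
  rw [intervalIntegral.integral_const_mul] at h2
  refine h2.trans ?_
  calc _ ≤ lam⁻¹ * (Real.pi / μ) := by gcongr
    _ = _ := by field_simp

theorem aux_sup1 (h h' : ℝ → ℂ) (R : ℝ) (hh : ∀ x, HasDerivAt h (h' x) x) (hh' : Continuous h')
    (h1 : h (-R) = 0) (x : ℝ) (hx : x ∈ Set.Icc (-R) R) :
    ‖h x‖ ≤ ∫ y in (-R)..R, ‖h' y‖ := by
  have := intervalIntegral.integral_eq_sub_of_hasDerivAt (a := -R) (b := x) (fun x _ => hh x)
    (hh'.intervalIntegrable _ _)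
  rw [h1, sub_zero] at this
  rw [← this]
  refine (intervalIntegral.norm_integral_le_integral_norm hx.1).trans ?_
  exact intervalIntegral.integral_mono_interval le_rfl hx.1 hx.2
    (Eventually.of_forall fun y => norm_nonneg _) (hh'.norm.intervalIntegrable _ _)

theorem aux_sup2 (h h' : ℝ → ℂ) (R S : ℝ) (hS : 0 ≤ S) (hh : ∀ x, HasDerivAt h (h' x) x)
    (hh' : Continuous h')
    (h1 : h (-R) = 0) (x : ℝ) (hx : x ∈ Set.Icc (-R) R)
    (hS1 : √(∫ y in (-R)..R, ‖h y‖ ^ 2) ≤ S) (hS2 : √(∫ y in (-R)..R, ‖h' y‖ ^ 2) ≤ S) :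
    ‖h x‖ ≤ 2 * S := by
  have ch : Continuous h := continuous_iff_continuousAt.2 fun x => (hh x).continuousAt
  have dd : ∀ x, HasDerivAt (fun x => h x ^ 2) (2 * h x * h' x) x := by
    intro x
    refine ((hh x).pow 2).congr_deriv ?_
    simp
  have b := aux_sup1 (fun x => h x ^ 2) (fun x => 2 * h x * h' x) R dd (by fun_prop)
    (by simp [h1]) x hx
  have cs := aux_CS_int (-R) R (by linarith [hx.1, hx.2]) (fun x => ‖h x‖) (fun x => ‖h' x‖)
    (fun _ => norm_nonneg _) (fun _ => norm_nonneg _) ch.norm hh'.norm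
  have e : ∫ y in (-R)..R, ‖2 * h y * h' y‖ = 2 * ∫ y in (-R)..R, ‖h y‖ * ‖h' y‖ := by
    rw [← intervalIntegral.integral_const_mul]
    congr 1; ext y; simp; ring
  simp only [norm_pow] at b
  rw [e] at b
  have : √(∫ y in (-R)..R, ‖h y‖ ^ 2) * √(∫ y in (-R)..R, ‖h' y‖ ^ 2) ≤ S * S := by gcongr
  apply le_of_sq_le_sq _ (by positivity)
  nlinarith

theorem aux_intsup (h : ℝ → ℂ) (w : ℝ → ℝ) (R s : ℝ) (hR : 0 < R) (ch : Continuous h)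
    (cw : Continuous w) (hw : ∀ x, 0 ≤ w x) (hs : ∀ x ∈ Set.Icc (-R) R, ‖h x‖ ≤ s) :
    ∫ x in (-R)..R, ‖h x‖ * w x ≤ s * ∫ x in (-R)..R, w x := by
  rw [← intervalIntegral.integral_const_mul]
  apply intervalIntegral.integral_mono_on (by linarith)
  · exact (ch.norm.mul cw).intervalIntegrable _ _
  · exact (continuous_const.mul cw).intervalIntegrable _ _
  · intro x hx
    exact mul_le_mul_of_nonneg_right (hs x hx) (hw x)

theorem aux_vdc1 (Φ p d : ℝ → ℝ) (h h' : ℝ → ℂ) (R lam : ℝ) (hR : 0 < R) (hl : 0 < lam)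
    (hΦ : ∀ x, HasDerivAt Φ (p x) x) (hp : ∀ x, HasDerivAt p (d x) x) (hd : Continuous d)
    (hd0 : ∀ x, 0 ≤ d x) (hdl : ∀ x, |x| ≤ R → lam ≤ d x)
    (hh : ∀ x, HasDerivAt h (h' x) x) (hh' : Continuous h') (h1 : h (-R) = 0) (h2 : h R = 0)
    (V : ℝ) (hV : ∫ y in (-R)..R, ‖h' y‖ ≤ V) :
    ‖∫ x in (-R)..R, Complex.exp (Complex.I * (Φ x : ℂ)) * h x‖ ≤ 8 * V / √lam := by
  have hμ : 0 < √lam := Real.sqrt_pos.2 hl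
  set μ := √lam with hμd
  have hμ2 : μ ^ 2 = lam := Real.sq_sqrt hl.le
  have cp : Continuous p := continuous_iff_continuousAt.2 fun x => (hp x).continuousAt
  have ch : Continuous h := continuous_iff_continuousAt.2 fun x => (hh x).continuousAt
  have hpos : ∀ x, 0 < p x ^ 2 + μ ^ 2 := fun x => by positivity
  have hne : ∀ x, p x ^ 2 + μ ^ 2 ≠ 0 := fun x => (hpos x).ne'
  have hV0 : 0 ≤ V := le_trans
    (intervalIntegral.integral_nonneg (by linarith) fun y _ => norm_nonneg _) hV
  have hs : ∀ x ∈ Set.Icc (-R) R, ‖h x‖ ≤ V := fun x hx =>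
    (aux_sup1 h h' R hh hh' h1 x hx).trans hV
  have main := aux_ibp Φ p d h h' R μ hR hμ hΦ hp hd hd0 hh hh' h1 h2
  have a1 := aux_arctan p d R μ hμ hp hd
  have a2 := aux_arctan2 p d R μ lam hR hμ hl hp hd hdl
  have t1 := aux_intsup h (fun x => μ ^ 2 / (p x ^ 2 + μ ^ 2)) R V hR ch
    (Continuous.div (by fun_prop) (by fun_prop) hne) (fun x => by positivity) hs
  have t3 := aux_intsup h (fun x => d x / (p x ^ 2 + μ ^ 2)) R V hR ch
    (Continuous.div (by fun_prop) (by fun_prop) hne)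
    (fun x => div_nonneg (hd0 x) (hpos x).le) hs
  have e1 : ∫ x in (-R)..R, μ ^ 2 / (p x ^ 2 + μ ^ 2) ≤ Real.pi / μ := by
    have : ∫ x in (-R)..R, μ ^ 2 / (p x ^ 2 + μ ^ 2)
        = μ ^ 2 * ∫ x in (-R)..R, 1 / (p x ^ 2 + μ ^ 2) := by
      rw [← intervalIntegral.integral_const_mul]
      congr 1; ext x; ring
    rw [this]
    calc _ ≤ μ ^ 2 * (Real.pi / (lam * μ)) := by gcongr
      _ = _ := by rw [← hμ2]; field_simp
  have t2 : ∫ x in (-R)..R, ‖h' x‖ * (|p x| / (p x ^ 2 + μ ^ 2)) ≤ V * (1 / μ) := by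
    calc _ ≤ ∫ x in (-R)..R, ‖h' x‖ * (1 / μ) := by
          apply intervalIntegral.integral_mono_on (by linarith)
          · exact (hh'.norm.mul
              (Continuous.div (by fun_prop) (by fun_prop) hne)).intervalIntegrable _ _
          · exact (hh'.norm.mul continuous_const).intervalIntegrable _ _
          · intro x hx
            refine mul_le_mul_of_nonneg_left ?_ (norm_nonneg _)
            rw [div_le_div_iff₀ (hpos x) hμ]
            nlinarith [sq_abs (p x), sq_nonneg (|p x| - μ), abs_nonneg (p x),
              mul_nonneg (abs_nonneg (p x)) hμ.le]
      _ = (∫ x in (-R)..R, ‖h' x‖) * (1 / μ) := by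
          rw [intervalIntegral.integral_mul_const]
      _ ≤ _ := by gcongr
  have t1' := mul_le_mul_of_nonneg_left e1 hV0
  have t3' := mul_le_mul_of_nonneg_left a1 hV0
  have hpi := Real.pi_lt_d2
  have : V * (Real.pi / μ) ≤ V * (3.15 / μ) := by gcongr
  have e : 8 * V / μ = V * (3.15 / μ) + V * (1 / μ) + V * (3.15 / μ) + 0.7 * V / μ := by ring
  have : 0 ≤ 0.7 * V / μ := by positivity
  rw [e]
  linarith

theorem aux_vdc2 (Φ p d : ℝ → ℝ) (h h' : ℝ → ℂ) (R lam : ℝ) (hR : 0 < R) (hl : 0 < lam)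
    (hΦ : ∀ x, HasDerivAt Φ (p x) x) (hp : ∀ x, HasDerivAt p (d x) x) (hd : Continuous d)
    (hd0 : ∀ x, 0 ≤ d x) (hdl : ∀ x, |x| ≤ R → lam ≤ d x)
    (hh : ∀ x, HasDerivAt h (h' x) x) (hh' : Continuous h') (h1 : h (-R) = 0) (h2 : h R = 0)
    (S : ℝ) (hS : 0 ≤ S)
    (hS1 : √(∫ y in (-R)..R, ‖h y‖ ^ 2) ≤ S) (hS2 : √(∫ y in (-R)..R, ‖h' y‖ ^ 2) ≤ S) :
    ‖∫ x in (-R)..R, Complex.exp (Complex.I * (Φ x : ℂ)) * h x‖ ≤ 16 * S / √lam := by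
  have hν : 0 < √lam := Real.sqrt_pos.2 hl
  have hν2 : √lam ^ 2 = lam := Real.sq_sqrt hl.le
  set ν := √lam with hνd
  have cp : Continuous p := continuous_iff_continuousAt.2 fun x => (hp x).continuousAt
  have ch : Continuous h := continuous_iff_continuousAt.2 fun x => (hh x).continuousAt
  have hs : ∀ x ∈ Set.Icc (-R) R, ‖h x‖ ≤ 2 * S := fun x hx =>
    aux_sup2 h h' R S hS hh hh' h1 x hx hS1 hS2
  have hpi := Real.pi_lt_d2
  have hpi0 := Real.pi_pos
  -- general facts for any μ
  have gen : ∀ μ : ℝ, 0 < μ → 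
      √(∫ x in (-R)..R, (|p x| / (p x ^ 2 + μ ^ 2)) ^ 2) ≤ √(Real.pi / (lam * μ)) := by
    intro μ hμ
    have hpos : ∀ x, 0 < p x ^ 2 + μ ^ 2 := fun x => by positivity
    have hne : ∀ x, p x ^ 2 + μ ^ 2 ≠ 0 := fun x => (hpos x).ne'
    apply Real.sqrt_le_sqrt
    refine le_trans ?_ (aux_arctan2 p d R μ lam hR hμ hl hp hd hdl)
    apply intervalIntegral.integral_mono_on (by linarith)
    · exact (Continuous.pow (Continuous.div (by fun_prop) (by fun_prop) hne) 2).intervalIntegrable _ _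
    · exact (Continuous.div (by fun_prop) (by fun_prop) hne).intervalIntegrable _ _
    · intro x hx
      rw [div_pow, sq_abs, div_le_div_iff₀ (pow_pos (hpos x) 2) (hpos x)]
      nlinarith [hpos x, sq_nonneg μ, mul_nonneg (hpos x).le (sq_nonneg μ)]
  have gen2 : ∀ μ : ℝ, 0 < μ → 
      ∫ x in (-R)..R, ‖h' x‖ * (|p x| / (p x ^ 2 + μ ^ 2)) ≤ S * √(Real.pi / (lam * μ)) := by
    intro μ hμ
    have hne : ∀ x, p x ^ 2 + μ ^ 2 ≠ 0 := fun x => by positivity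
    refine (aux_CS_int (-R) R (by linarith) (fun x => ‖h' x‖)
      (fun x => |p x| / (p x ^ 2 + μ ^ 2)) (fun _ => norm_nonneg _) (fun x => by positivity)
      hh'.norm (Continuous.div (by fun_prop) (by fun_prop) hne)).trans ?_
    exact mul_le_mul hS2 (gen μ hμ) (Real.sqrt_nonneg _) hS
  have gen3 : ∀ μ : ℝ, 0 < μ → 
      ∫ x in (-R)..R, ‖h x‖ * (d x / (p x ^ 2 + μ ^ 2)) ≤ 2 * S * (Real.pi / μ) := by
    intro μ hμ
    have hne : ∀ x, p x ^ 2 + μ ^ 2 ≠ 0 := fun x => by positivity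
    refine (aux_intsup h (fun x => d x / (p x ^ 2 + μ ^ 2)) R (2 * S) hR ch
      (Continuous.div (by fun_prop) (by fun_prop) hne)
      (fun x => div_nonneg (hd0 x) (by positivity)) hs).trans ?_
    exact mul_le_mul_of_nonneg_left (aux_arctan p d R μ hμ hp hd) (by positivity)
  rcases le_total 1 lam with hl1 | hl1
  · have hne : ∀ x, p x ^ 2 + ν ^ 2 ≠ 0 := fun x => by positivity
    have hν1 : 1 ≤ ν := Real.one_le_sqrt.2 hl1
    have main := aux_ibp Φ p d h h' R ν hR hν hΦ hp hd hd0 hh hh' h1 h2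
    have t1 := aux_intsup h (fun x => ν ^ 2 / (p x ^ 2 + ν ^ 2)) R (2 * S) hR ch
      (Continuous.div (by fun_prop) (by fun_prop) hne) (fun x => by positivity) hs
    have e1 : ∫ x in (-R)..R, ν ^ 2 / (p x ^ 2 + ν ^ 2) ≤ Real.pi / ν := by
      have : ∫ x in (-R)..R, ν ^ 2 / (p x ^ 2 + ν ^ 2)
          = ν ^ 2 * ∫ x in (-R)..R, 1 / (p x ^ 2 + ν ^ 2) := by
        rw [← intervalIntegral.integral_const_mul]
        congr 1; ext x; ring
      rw [this]
      calc _ ≤ ν ^ 2 * (Real.pi / (lam * ν)) := by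
            gcongr
            exact aux_arctan2 p d R ν lam hR hν hl hp hd hdl
        _ = _ := by rw [← hν2]; field_simp
    have t1' := mul_le_mul_of_nonneg_left e1 (show 0 ≤ 2 * S by positivity)
    have t2 := gen2 ν hν
    have t3 := gen3 ν hν
    have e2 : √(Real.pi / (lam * ν)) ≤ 2 / ν := by
      apply Real.sqrt_le_iff.2 ⟨by positivity, ?_⟩
      rw [div_pow, div_le_div_iff₀ (by positivity) (by positivity), hν2]
      nlinarith
    have e2' := mul_le_mul_of_nonneg_left e2 hS
    have : 2 * S * (Real.pi / ν) ≤ 2 * S * (3.15 / ν) := by gcongr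
    have e : 16 * S / ν = 2 * S * (3.15 / ν) + S * (2 / ν) + 2 * S * (3.15 / ν) + 1.4 * S / ν := by
      ring
    have : 0 ≤ 1.4 * S / ν := by positivity
    rw [e]
    linarith
  · have hne : ∀ x, p x ^ 2 + (1:ℝ) ^ 2 ≠ 0 := fun x => by positivity
    have hpos : ∀ x, 0 < p x ^ 2 + (1:ℝ) ^ 2 := fun x => by positivity
    have hν1 : ν ≤ 1 := by rw [hνd]; exact Real.sqrt_le_one.2 hl1
    have main := aux_ibp Φ p d h h' R 1 hR one_pos hΦ hp hd hd0 hh hh' h1 h2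
    have e2 : √(Real.pi / (lam * 1)) ≤ 2 / ν := by
      apply Real.sqrt_le_iff.2 ⟨by positivity, ?_⟩
      rw [div_pow, div_le_div_iff₀ (by positivity) (by positivity), hν2]
      nlinarith
    have t2 := gen2 1 one_pos
    have t3 := gen3 1 one_pos
    have t1 : ∫ x in (-R)..R, ‖h x‖ * (1 ^ 2 / (p x ^ 2 + 1 ^ 2)) ≤ S * √(Real.pi / (lam * 1)) := by
      refine (aux_CS_int (-R) R (by linarith) (fun x => ‖h x‖)
        (fun x => 1 ^ 2 / (p x ^ 2 + 1 ^ 2)) (fun _ => norm_nonneg _) (fun x => by positivity)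
        ch.norm (Continuous.div (by fun_prop) (by fun_prop) hne)).trans ?_
      refine mul_le_mul hS1 ?_ (Real.sqrt_nonneg _) hS
      apply Real.sqrt_le_sqrt
      refine le_trans ?_ (aux_arctan2 p d R 1 lam hR one_pos hl hp hd hdl)
      apply intervalIntegral.integral_mono_on (by linarith)
      · exact (Continuous.pow (Continuous.div (by fun_prop) (by fun_prop) hne) 2).intervalIntegrable _ _
      · exact (Continuous.div (by fun_prop) (by fun_prop) hne).intervalIntegrable _ _
      · intro x hx
        rw [div_pow, div_le_div_iff₀ (pow_pos (hpos x) 2) (hpos x)]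
        nlinarith [hpos x, sq_nonneg (p x)]
    have e2' := mul_le_mul_of_nonneg_left e2 hS
    have e3 : Real.pi / 1 ≤ 3.15 / ν := by
      rw [div_le_div_iff₀ one_pos hν]; nlinarith
    have : 2 * S * (Real.pi / 1) ≤ 2 * S * (3.15 / ν) := by gcongr
    have e : 16 * S / ν = S * (2 / ν) + S * (2 / ν) + 2 * S * (3.15 / ν) + 5.7 * S / ν := by
      ring
    have : 0 ≤ 5.7 * S / ν := by positivity
    rw [e]
    linarith

theorem aux_phase (x t : ℝ) (ht : 0 < t) :
    (∀ ξ : ℝ, HasDerivAt (fun ξ => x * ξ + t * √(1 + ξ ^ 2)) (x + t * ξ / √(1 + ξ ^ 2)) ξ) ∧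
    (∀ ξ : ℝ, HasDerivAt (fun ξ => x + t * ξ / √(1 + ξ ^ 2)) (t / √(1 + ξ ^ 2) ^ 3) ξ) ∧
    Continuous (fun ξ : ℝ => t / √(1 + ξ ^ 2) ^ 3) ∧
    (∀ ξ : ℝ, 0 ≤ t / √(1 + ξ ^ 2) ^ 3) := by
  have hpos : ∀ ξ : ℝ, 0 < 1 + ξ ^ 2 := fun ξ => by positivity
  have hs : ∀ ξ : ℝ, 0 < √(1 + ξ ^ 2) := fun ξ => Real.sqrt_pos.2 (hpos ξ)
  have ds : ∀ ξ : ℝ, HasDerivAt (fun ξ => √(1 + ξ ^ 2)) (ξ / √(1 + ξ ^ 2)) ξ := by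
    intro ξ
    have := (((hasDerivAt_id ξ).pow 2).const_add 1).sqrt (hpos ξ).ne'
    refine this.congr_deriv ?_
    have := hs ξ
    simp
    field_simp
  refine ⟨fun ξ => ?_, fun ξ => ?_, ?_, fun ξ => by have := hs ξ; positivity⟩
  · refine (((hasDerivAt_id ξ).const_mul x).add ((ds ξ).const_mul t)).congr_deriv ?_
    ring
  · refine ((((hasDerivAt_id ξ).const_mul t).div (ds ξ) (hs ξ).ne').const_add x).congr_deriv ?_
    have h := hs ξ
    have h2 : √(1 + ξ ^ 2) ^ 2 = 1 + ξ ^ 2 := Real.sq_sqrt (hpos ξ).le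
    simp only [id]
    field_simp
    rw [h2]; ring
  · exact Continuous.div (by fun_prop) (by fun_prop) fun ξ => (pow_pos (hs ξ) 3).ne'

theorem aux_schwartz (f : SchwartzMap ℝ ℂ) : ∃ G : SchwartzMap ℝ ℂ, FT (⇑f) = ⇑G := by
  have hc : (2 * Real.pi)⁻¹ ≠ 0 := by positivity
  let e : ℝ ≃L[ℝ] ℝ := ContinuousLinearEquiv.unitsEquivAut ℝ (Units.mk0 _ hc)
  refine ⟨(Real.sqrt (2 * Real.pi) : ℂ)⁻¹ •
    SchwartzMap.compCLMOfContinuousLinearEquiv ℂ e (FourierTransform.fourier f), ?_⟩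
  ext ξ
  simp only [FT, smul_apply, SchwartzMap.compCLMOfContinuousLinearEquiv_apply,
    smul_eq_mul, Function.comp, SchwartzMap.fourier_coe]
  congr 1
  rw [Real.fourier_real_eq_integral_exp_smul]
  congr 1; ext v
  rw [smul_eq_mul]
  congr 2
  have : e ξ = ξ * (2 * Real.pi)⁻¹ := rfl
  rw [this]
  have : -2 * Real.pi * v * (ξ * (2 * Real.pi)⁻¹) = - (v * ξ) := by field_simp
  rw [this]; push_cast; ring

theorem aux_weight (G : SchwartzMap ℝ ℂ) :
    MemLp (fun ξ : ℝ => ((1 + ξ ^ 2 : ℝ) : ℂ) * G ξ) 2 volume := by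
  have hg : Function.HasTemperateGrowth (fun ξ : ℝ => ((1 + ξ ^ 2 : ℝ) : ℂ)) := by
    have : Function.HasTemperateGrowth (fun ξ : ℝ => (1 + ξ ^ 2 : ℝ)) := by fun_prop
    exact (Complex.ofRealCLM.hasTemperateGrowth).comp this
  have := (SchwartzMap.smulLeftCLM ℂ (fun ξ : ℝ => ((1 + ξ ^ 2 : ℝ) : ℂ)) G).memLp 2 volume
  rw [SchwartzMap.smulLeftCLM_apply hg] at this
  exact this

theorem aux_cutoff_le (φ : ℝ → ℝ) (hφ0 : ∀ x, 0 ≤ φ x) (hφ1 : ∀ x, φ x ≤ 1) (n ℓ : ℕ) (ξ : ℝ) :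
    |cutoff φ n ℓ ξ| ≤ 1 := by
  unfold cutoff
  split_ifs <;> rw [abs_le]
  · constructor <;> linarith [hφ0 (2 ^ 101 * (|ξ| - √3)), hφ1 (2 ^ 101 * (|ξ| - √3))]
  · constructor <;> linarith [hφ0 (2 ^ (n + 100) * (|ξ| - √3)), hφ1 (2 ^ (n + 100) * (|ξ| - √3))]
  · constructor <;> linarith [hφ0 (2 ^ (ℓ + 100) * (|ξ| - √3)), hφ1 (2 ^ (ℓ + 100) * (|ξ| - √3)),
      hφ0 (2 ^ (ℓ + 101) * (|ξ| - √3)), hφ1 (2 ^ (ℓ + 101) * (|ξ| - √3))]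

theorem aux_cutoff_cont (φ : ℝ → ℝ) (hφ : Continuous φ) (n ℓ : ℕ) :
    Continuous (cutoff φ n ℓ) := by
  unfold cutoff
  split_ifs <;> fun_prop

theorem aux_cutoff_sum (φ : ℝ → ℝ) (n : ℕ) (hn : 1 ≤ n) (ξ : ℝ) :
    ∑ ℓ ∈ Finset.range (n + 1), cutoff φ n ℓ ξ = 1 := by
  obtain ⟨m, rfl⟩ : ∃ m, n = m + 1 := ⟨n - 1, by omega⟩
  rw [Finset.sum_range_succ, Finset.sum_range_succ']
  have : ∑ i ∈ Finset.range m, cutoff φ (m + 1) (i + 1) ξ =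
      ∑ i ∈ Finset.range m, ((fun i : ℕ => φ (2 ^ (i + 101) * (|ξ| - √3))) i -
        (fun i : ℕ => φ (2 ^ (i + 101) * (|ξ| - √3))) (i + 1)) := by
    apply Finset.sum_congr rfl
    intro i hi
    have : i < m := Finset.mem_range.1 hi
    have h1 : i ≠ m := by omega
    simp only [cutoff, Nat.add_eq_zero_iff, one_ne_zero, and_false, if_false, add_left_inj, h1]
  rw [this, Finset.sum_range_sub']
  simp [cutoff]

theorem aux_cutoff_zero (φ : ℝ → ℝ) (hφzero : ∀ x : ℝ, 2 ≤ |x| → φ x = 0) (n ℓ : ℕ) (hℓ : ℓ ≠ 0)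
    (ξ : ℝ) (h : 2 ≤ 2 ^ (ℓ + 100) * |(|ξ| - √3)|) : cutoff φ n ℓ ξ = 0 := by
  have h1 : φ (2 ^ (ℓ + 100) * (|ξ| - √3)) = 0 := by
    apply hφzero; rw [abs_mul, abs_of_pos (by positivity)]; exact h
  have h2 : φ (2 ^ (ℓ + 101) * (|ξ| - √3)) = 0 := by
    apply hφzero; rw [abs_mul, abs_of_pos (by positivity)]
    have : (2:ℝ) ^ (ℓ + 101) = 2 * 2 ^ (ℓ + 100) := by rw [pow_succ]; ring
    rw [this]; nlinarith
  unfold cutoff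
  rw [if_neg hℓ]
  split_ifs with h3
  · rw [← h3, h1]
  · rw [h1, h2, sub_zero]

theorem aux_L1 (S : Set ℝ) (hS : MeasurableSet S) (c : ℝ) (hc : 0 ≤ c)
    (hv : volume S ≤ ENNReal.ofReal c)
    (F : ℝ → ℝ) (hF0 : ∀ x, 0 ≤ F x) (hF : MemLp F 2 volume) :
    ∫ x in S, F x ≤ √c * √(∫ x, F x ^ 2) := by
  have : IsFiniteMeasure (volume.restrict S) :=
    ⟨by rw [Measure.restrict_apply_univ]; exact lt_of_le_of_lt hv ENNReal.ofReal_lt_top⟩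
  have h := aux_CS_s13 (volume.restrict S) (fun _ => 1) F (fun _ => zero_le_one) hF0 (memLp_const 1)
    (hF.restrict S)
  simp only [one_mul, one_pow] at h
  refine h.trans ?_
  have hi : Integrable (fun x => F x ^ 2) volume :=
    (memLp_two_iff_integrable_sq hF.1).1 hF
  gcongr
  · simp only [integral_const, smul_eq_mul, mul_one, Measure.real, Measure.restrict_apply_univ]
    exact ENNReal.toReal_le_of_le_ofReal hc hv
  · exact Eventually.of_forall fun x => sq_nonneg (F x)
  · exact Measure.restrict_le_self

theorem aux_Bn_sup_nonneg (φ : ℝ → ℝ) (n : ℕ) (g : ℝ → ℂ) :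
    0 ≤ ⨆ ℓ : Fin (n + 1), (2 : ℝ) ^ (-(((ℓ : ℕ) : ℝ)) / 2) *
        (∫ ξ : ℝ, ‖(cutoff φ n (ℓ : ℕ) ξ : ℂ) * ((1 + ξ ^ 2 : ℝ) : ℂ) *
            deriv g ξ‖ ^ 2) ^ ((1 : ℝ) / 2) :=
  Real.iSup_nonneg fun ℓ => by positivity

theorem aux_Bn_A (φ : ℝ → ℝ) (n : ℕ) (f : ℝ → ℂ) :
    √(∫ ξ : ℝ, ‖((1 + ξ ^ 2 : ℝ) : ℂ) * FT f ξ‖ ^ 2) ≤ Bn φ n f := by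
  rw [Real.sqrt_eq_rpow]
  exact le_add_of_nonneg_right (aux_Bn_sup_nonneg φ n (FT f))

theorem aux_Bn_M (φ : ℝ → ℝ) (n : ℕ) (f : ℝ → ℂ) (ℓ : ℕ) (hℓ : ℓ < n + 1) :
    √(∫ ξ : ℝ, ‖(cutoff φ n ℓ ξ : ℂ) * ((1 + ξ ^ 2 : ℝ) : ℂ) * deriv (FT f) ξ‖ ^ 2)
      ≤ √(2 ^ ℓ) * Bn φ n f := by
  have h := le_ciSup (f := fun ℓ : Fin (n + 1) => (2 : ℝ) ^ (-(((ℓ : ℕ) : ℝ)) / 2) *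
        (∫ ξ : ℝ, ‖(cutoff φ n (ℓ : ℕ) ξ : ℂ) * ((1 + ξ ^ 2 : ℝ) : ℂ) *
            deriv (FT f) ξ‖ ^ 2) ^ ((1 : ℝ) / 2)) (Set.finite_range _).bddAbove ⟨ℓ, hℓ⟩
  have h2 : (2 : ℝ) ^ (-((ℓ : ℝ)) / 2) * √(∫ ξ : ℝ, ‖(cutoff φ n ℓ ξ : ℂ) *
      ((1 + ξ ^ 2 : ℝ) : ℂ) * deriv (FT f) ξ‖ ^ 2) ≤ Bn φ n f := by
    rw [Real.sqrt_eq_rpow]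
    refine h.trans ?_
    exact le_add_of_nonneg_left (by positivity)
  have e : √((2:ℝ) ^ ℓ) * (2 : ℝ) ^ (-((ℓ : ℝ)) / 2) = 1 := by
    rw [Real.sqrt_eq_rpow, ← Real.rpow_natCast, ← Real.rpow_mul (by norm_num),
      ← Real.rpow_add (by norm_num)]
    ring_nf; simp
  have h3 := mul_le_mul_of_nonneg_left h2 (Real.sqrt_nonneg ((2:ℝ) ^ ℓ))
  rwa [← mul_assoc, e, one_mul] at h3

/-- derivative of the Littlewood–Paley symbol -/
def lpSymbD (φ : ℝ → ℝ) (k : ℕ) (ξ : ℝ) : ℝ :=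
  deriv φ (((2 : ℝ) ^ k)⁻¹ * ξ) * ((2 : ℝ) ^ k)⁻¹
    - deriv φ (2 * (((2 : ℝ) ^ k)⁻¹ * ξ)) * (2 * ((2 : ℝ) ^ k)⁻¹)

theorem aux_lp_deriv (φ : ℝ → ℝ) (hφ : Differentiable ℝ φ) (k : ℕ) (ξ : ℝ) :
    HasDerivAt (lpSymb φ k) (lpSymbD φ k ξ) ξ := by
  have h1 : HasDerivAt (fun ξ : ℝ => ((2 : ℝ) ^ k)⁻¹ * ξ) ((2 : ℝ) ^ k)⁻¹ ξ := by
    simpa using (hasDerivAt_id ξ).const_mul ((2 : ℝ) ^ k)⁻¹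
  have h2 := h1.const_mul 2
  have a := (hφ (((2 : ℝ) ^ k)⁻¹ * ξ)).hasDerivAt.comp ξ h1
  have b := (hφ (2 * (((2 : ℝ) ^ k)⁻¹ * ξ))).hasDerivAt.comp ξ h2
  exact a.sub b

theorem aux_lp_le (φ : ℝ → ℝ) (hφ0 : ∀ x, 0 ≤ φ x) (hφ1 : ∀ x, φ x ≤ 1) (k : ℕ) (ξ : ℝ) :
    |lpSymb φ k ξ| ≤ 1 := by
  unfold lpSymb
  rw [abs_le]
  constructor <;> linarith [hφ0 (((2 : ℝ) ^ k)⁻¹ * ξ), hφ1 (((2 : ℝ) ^ k)⁻¹ * ξ),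
    hφ0 (2 * (((2 : ℝ) ^ k)⁻¹ * ξ)), hφ1 (2 * (((2 : ℝ) ^ k)⁻¹ * ξ))]

theorem aux_lpD_le (φ : ℝ → ℝ) (D : ℝ) (hD : ∀ x, |deriv φ x| ≤ D) (k : ℕ) (ξ : ℝ) :
    |lpSymbD φ k ξ| ≤ 3 * D := by
  unfold lpSymbD
  have hD0 : 0 ≤ D := (abs_nonneg _).trans (hD 0)
  have h1 : ((2 : ℝ) ^ k)⁻¹ ≤ 1 := inv_le_one_of_one_le₀ (one_le_pow₀ (by norm_num))
  have h0 : 0 ≤ ((2 : ℝ) ^ k)⁻¹ := by positivity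
  refine (abs_sub _ _).trans ?_
  rw [abs_mul, abs_mul, abs_of_nonneg h0, abs_of_nonneg (by positivity : 0 ≤ 2 * ((2 : ℝ) ^ k)⁻¹)]
  have a := mul_le_mul (hD (((2 : ℝ) ^ k)⁻¹ * ξ)) h1 h0 hD0
  have b := mul_le_mul (hD (2 * (((2 : ℝ) ^ k)⁻¹ * ξ)))
    (by linarith : 2 * ((2 : ℝ) ^ k)⁻¹ ≤ 2) (by positivity) hD0
  linarith

theorem aux_lp_out (φ : ℝ → ℝ) (hφzero : ∀ x : ℝ, 2 ≤ |x| → φ x = 0) (k : ℕ) (ξ : ℝ)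
    (h : 2 * 2 ^ k ≤ |ξ|) : lpSymb φ k ξ = 0 := by
  have h0 : (0:ℝ) < ((2 : ℝ) ^ k)⁻¹ := by positivity
  have h1 : 2 ≤ ((2 : ℝ) ^ k)⁻¹ * |ξ| := by
    rw [inv_mul_eq_div, le_div_iff₀ (by positivity)]; exact h
  unfold lpSymb
  rw [hφzero, hφzero, sub_zero]
  · rw [abs_mul, abs_mul, abs_of_pos h0, abs_two]; linarith
  · rw [abs_mul, abs_of_pos h0]; exact h1

theorem aux_deriv_in (φ : ℝ → ℝ) (hφone : ∀ x : ℝ, |x| ≤ 1 → φ x = 1) (x : ℝ) (h : |x| < 1) :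
    deriv φ x = 0 := by
  have : φ =ᶠ[𝓝 x] fun _ => 1 := by
    have : ∀ᶠ y in 𝓝 x, |y| < 1 := (continuous_abs.tendsto x).eventually_lt_const h
    filter_upwards [this] with y hy using hφone y hy.le
  rw [this.deriv_eq]; simp

theorem aux_lp_in (φ : ℝ → ℝ) (hφone : ∀ x : ℝ, |x| ≤ 1 → φ x = 1) (k : ℕ) (ξ : ℝ)
    (h : 2 * |ξ| < 2 ^ k) : lpSymb φ k ξ = 0 ∧ lpSymbD φ k ξ = 0 := by
  have h0 : (0:ℝ) < ((2 : ℝ) ^ k)⁻¹ := by positivity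
  have h1 : 2 * (((2 : ℝ) ^ k)⁻¹ * |ξ|) < 1 := by
    have : 2 * (((2 : ℝ) ^ k)⁻¹ * |ξ|) = (2 * |ξ|) / 2 ^ k := by ring
    rw [this, div_lt_one (by positivity)]; exact h
  have hz : 0 ≤ ((2 : ℝ) ^ k)⁻¹ * |ξ| := by positivity
  have a1 : |((2 : ℝ) ^ k)⁻¹ * ξ| < 1 := by rw [abs_mul, abs_of_pos h0]; linarith
  have a2 : |2 * (((2 : ℝ) ^ k)⁻¹ * ξ)| < 1 := by
    rw [abs_mul, abs_mul, abs_of_pos h0, abs_two]; linarith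
  constructor
  · unfold lpSymb; rw [hφone _ a1.le, hφone _ a2.le, sub_self]
  · unfold lpSymbD; rw [aux_deriv_in φ hφone _ a1, aux_deriv_in φ hφone _ a2]; simp

theorem aux_near_L1 (φ : ℝ → ℝ) (hφc : Continuous φ) (hφ0 : ∀ x, 0 ≤ φ x) (hφ1 : ∀ x, φ x ≤ 1)
    (hφzero : ∀ x : ℝ, 2 ≤ |x| → φ x = 0) (n : ℕ) (f : SchwartzMap ℝ ℂ)
    (ℓ : ℕ) (hℓ0 : ℓ ≠ 0) (hℓ : ℓ < n + 1) (R : ℝ) (hR : 0 ≤ R)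
    (hm : MemLp (fun ξ : ℝ => ‖(cutoff φ n ℓ ξ : ℂ) * ((1 + ξ ^ 2 : ℝ) : ℂ) *
      deriv (FT f) ξ‖) 2 volume) :
    ∫ ξ in (-R)..R, ‖(cutoff φ n ℓ ξ : ℂ) * ((1 + ξ ^ 2 : ℝ) : ℂ) * deriv (FT f) ξ‖
      ≤ Bn φ n f := by
  set F : ℝ → ℝ := fun ξ => ‖(cutoff φ n ℓ ξ : ℂ) * ((1 + ξ ^ 2 : ℝ) : ℂ) * deriv (FT f) ξ‖
    with hFd
  set δ : ℝ := 2 / 2 ^ (ℓ + 100) with hδ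
  have hδ0 : 0 < δ := by positivity
  set S : Set ℝ := Set.Icc (√3 - δ) (√3 + δ) ∪ Set.Icc (-√3 - δ) (-√3 + δ) with hSd
  have hSm : MeasurableSet S := measurableSet_Icc.union measurableSet_Icc
  have hv : volume S ≤ ENNReal.ofReal (1 / 2 ^ ℓ) := by
    refine (measure_union_le _ _).trans ?_
    rw [Real.volume_Icc, Real.volume_Icc, ← ENNReal.ofReal_add (by linarith) (by linarith)]
    apply ENNReal.ofReal_le_ofReal
    have : δ * 4 ≤ 1 / 2 ^ ℓ := by
      rw [hδ, div_mul_eq_mul_div, div_le_div_iff₀ (by positivity) (by positivity), pow_add]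
      have : (0:ℝ) < 2 ^ ℓ := by positivity
      nlinarith
    linarith
  have hz : ∀ ξ, ξ ∉ S → F ξ = 0 := by
    intro ξ hξ
    have : cutoff φ n ℓ ξ = 0 := by
      apply aux_cutoff_zero φ hφzero n ℓ hℓ0
      by_contra hcon
      push Not at hcon
      apply hξ
      have h2 : |(|ξ| - √3)| < δ := by
        rw [hδ, lt_div_iff₀ (by positivity)]; linarith
      rw [abs_lt] at h2
      rcases abs_cases ξ with ⟨h3, _⟩ | ⟨h3, _⟩ <;> rw [h3] at h2
      · left; constructor <;> linarith
      · right; constructor <;> linarith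
    simp [hFd, this]
  have hF0 : ∀ ξ, 0 ≤ F ξ := fun ξ => norm_nonneg _
  have e := aux_L1 S hSm (1 / 2 ^ ℓ) (by positivity) hv F hF0 hm
  have hi : Integrable F volume := by
    have : IntegrableOn F S volume := by
      have : IsFiniteMeasure (volume.restrict S) :=
        ⟨by rw [Measure.restrict_apply_univ]; exact lt_of_le_of_lt hv ENNReal.ofReal_lt_top⟩
      exact (hm.restrict S).integrable (by norm_num)
    exact (integrableOn_iff_integrable_of_support_subset (fun ξ hξ => by
      by_contra h; exact hξ (hz ξ h))).1 this
  have e2 : ∫ ξ in S, F ξ = ∫ ξ, F ξ := by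
    apply setIntegral_eq_integral_of_forall_compl_eq_zero
    intro ξ h; exact hz ξ h
  have e3 : ∫ ξ in (-R)..R, F ξ ≤ ∫ ξ, F ξ := by
    rw [intervalIntegral.integral_of_le (by linarith)]
    exact setIntegral_le_integral hi (Eventually.of_forall hF0)
  have hM := aux_Bn_M φ n f ℓ hℓ
  rw [← e2] at e3
  refine e3.trans (e.trans ?_)
  calc _ ≤ √(1 / 2 ^ ℓ) * (√(2 ^ ℓ) * Bn φ n f) := by gcongr
    _ = _ := by
      rw [← mul_assoc, ← Real.sqrt_mul (by positivity), one_div_mul_cancel (by positivity)]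
      simp

theorem aux_int_L1 (R : ℝ) (hR : 0 ≤ R) (hR4 : R ≤ 4) (F : ℝ → ℝ) (hF0 : ∀ x, 0 ≤ F x)
    (hF : MemLp F 2 volume) : ∫ x in (-R)..R, F x ≤ 3 * √(∫ x, F x ^ 2) := by
  rw [intervalIntegral.integral_of_le (by linarith)]
  refine (aux_L1 (Set.Ioc (-R) R) measurableSet_Ioc 9 (by norm_num) ?_ F hF0 hF).trans ?_
  · rw [Real.volume_Ioc]; apply ENNReal.ofReal_le_ofReal; linarith
  · have : √(9:ℝ) = 3 := by rw [show (9:ℝ) = 3 ^ 2 by norm_num]; exact Real.sqrt_sq (by norm_num)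
    rw [this]

theorem aux_memLp_cut (φ : ℝ → ℝ) (hφc : Continuous φ) (hφ0 : ∀ x, 0 ≤ φ x) (hφ1 : ∀ x, φ x ≤ 1)
    (n ℓ : ℕ) (G : SchwartzMap ℝ ℂ) :
    MemLp (fun ξ : ℝ => ‖(cutoff φ n ℓ ξ : ℂ) * ((1 + ξ ^ 2 : ℝ) : ℂ) * deriv (⇑G) ξ‖) 2 volume := by
  have h := aux_weight (SchwartzMap.derivCLM ℂ ℂ G)
  have hcc := aux_cutoff_cont φ hφc n ℓ
  have hdc : Continuous (deriv (⇑G)) := (SchwartzMap.derivCLM ℂ ℂ G).continuous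
  refine h.mono (Continuous.aestronglyMeasurable (by fun_prop)) (Eventually.of_forall fun ξ => ?_)
  rw [norm_norm, mul_assoc, norm_mul, Complex.norm_real, Real.norm_eq_abs]
  have := mul_le_mul_of_nonneg_right (aux_cutoff_le φ hφ0 hφ1 n ℓ ξ)
    (norm_nonneg (((1 + ξ ^ 2 : ℝ) : ℂ) * deriv (⇑G) ξ))
  rw [one_mul] at this
  exact this

set_option maxHeartbeats 4000000 in
/-- Dispersive decay estimate with a high-frequency gain for the half Klein–Gordon
propagator applied to a Littlewood–Paley piece. -/
theorem dispersive_decay_estimate_with_gain (φ : ℝ → ℝ) (hφsmooth : ContDiff ℝ (⊤ : ℕ∞) φ)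
    (hφeven : ∀ x, φ (-x) = φ x) (hφ0 : ∀ x, 0 ≤ φ x) (hφ1 : ∀ x, φ x ≤ 1)
    (hφone : ∀ x : ℝ, |x| ≤ 1 → φ x = 1) (hφzero : ∀ x : ℝ, 2 ≤ |x| → φ x = 0) :
    ∃ C : ℝ, 1 ≤ C ∧
      ∀ n : ℕ, 1 ≤ n → ∀ k : ℕ, ∀ f : SchwartzMap ℝ ℂ, ∀ t : ℝ, 1 ≤ t → ∀ x : ℝ,
        ‖propagatorPk φ k t (⇑f) x‖ ≤
          C * ((2 : ℝ) ^ (-((k : ℝ)) / 2) * (n : ℝ) / Real.sqrt t) * Bn φ n (⇑f) := by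
  have hφc : Continuous φ := hφsmooth.continuous
  have hφd : Differentiable ℝ φ := hφsmooth.differentiable (by simp)
  have hφdc : Continuous (deriv φ) := hφsmooth.continuous_deriv (by simp)
  obtain ⟨D, hD⟩ : ∃ D, ∀ x, |deriv φ x| ≤ D := by
    have hcs : HasCompactSupport φ := by
      apply HasCompactSupport.intro (isCompact_Icc (a := (-2:ℝ)) (b := 2))
      intro x hx
      apply hφzero
      by_contra hcon
      push Not at hcon
      exact hx (abs_le.1 hcon.le)
    exact hcs.deriv.exists_bound_of_continuous hφdc
  have hD0 : 0 ≤ D := (abs_nonneg _).trans (hD 0)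
  refine ⟨1280 * (D + 1), by linarith, ?_⟩
  intro n hn k f t ht x
  have ht0 : 0 < t := by linarith
  have hn1 : (1:ℝ) ≤ n := by exact_mod_cast hn
  obtain ⟨G, hG⟩ := aux_schwartz f
  have hAB := aux_Bn_A φ n f
  have hMB := aux_Bn_M φ n f
  have hmemc : ∀ ℓ, MemLp (fun ξ : ℝ => ‖(cutoff φ n ℓ ξ : ℂ) * ((1 + ξ ^ 2 : ℝ) : ℂ) *
      deriv (FT f) ξ‖) 2 volume := by
    intro ℓ; rw [hG]; exact aux_memLp_cut φ hφc hφ0 hφ1 n ℓ G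
  have hmemw : MemLp (fun ξ : ℝ => ‖((1 + ξ ^ 2 : ℝ) : ℂ) * FT f ξ‖) 2 volume := by
    rw [hG]; exact (aux_weight G).norm
  have hnear := fun ℓ hℓ0 hℓ R hR => aux_near_L1 φ hφc hφ0 hφ1 hφzero n f ℓ hℓ0 hℓ R hR (hmemc ℓ)
  have hgd : ∀ ξ, HasDerivAt (FT f) (deriv (FT f) ξ) ξ := by
    rw [hG]; intro ξ; exact G.differentiableAt.hasDerivAt
  have hgdc : Continuous (deriv (FT f)) := by
    rw [hG]; exact (SchwartzMap.derivCLM ℂ ℂ G).continuous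
  have hgc : Continuous (FT f) := by rw [hG]; exact G.continuous
  set B := Bn φ n f with hB
  have hB0 : 0 ≤ B := (Real.sqrt_nonneg _).trans hAB
  set g := FT (⇑f) with hg
  -- the amplitude
  set h : ℝ → ℂ := fun ξ => (lpSymb φ k ξ : ℂ) * g ξ with hh
  set h' : ℝ → ℂ := fun ξ => (lpSymbD φ k ξ : ℂ) * g ξ + (lpSymb φ k ξ : ℂ) * deriv g ξ with hh'
  have dh : ∀ ξ, HasDerivAt h (h' ξ) ξ := fun ξ =>
    ((aux_lp_deriv φ hφd k ξ).ofReal_comp).mul (hgd ξ)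
  have clp : Continuous (lpSymb φ k) := by unfold lpSymb; fun_prop
  have clpD : Continuous (lpSymbD φ k) := by unfold lpSymbD; fun_prop
  have ch : Continuous h := by fun_prop
  have ch' : Continuous h' := by fun_prop
  set R : ℝ := 2 * 2 ^ k with hRd
  have hR : 0 < R := by positivity
  have hout : ∀ ξ, R ≤ |ξ| → h ξ = 0 := by
    intro ξ hξ; simp [hh, aux_lp_out φ hφzero k ξ hξ]
  have h1 : h (-R) = 0 := hout _ (by rw [abs_neg, abs_of_pos hR])
  have h2 : h R = 0 := hout _ (by rw [abs_of_pos hR])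
  obtain ⟨P1, P2, P3, P4⟩ := aux_phase x t ht0
  set lam : ℝ := t / (16 * 8 ^ k) with hlam
  have hl : 0 < lam := by positivity
  have p2 : (1:ℝ) ≤ 2 ^ k := one_le_pow₀ (by norm_num)
  have e4 : (4:ℝ) ^ k = (2 ^ k) ^ 2 := by rw [← pow_mul, mul_comm, pow_mul]; norm_num
  have e8 : (8:ℝ) ^ k = (2 ^ k) ^ 3 := by rw [← pow_mul, mul_comm, pow_mul]; norm_num
  have hdl : ∀ ξ, |ξ| ≤ R → lam ≤ t / √(1 + ξ ^ 2) ^ 3 := by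
    intro ξ hξ
    have hs : √(1 + ξ ^ 2) ≤ 2.5 * 2 ^ k := by
      apply Real.sqrt_le_iff.2 ⟨by positivity, ?_⟩
      have : ξ ^ 2 ≤ R ^ 2 := sq_le_sq' (abs_le.1 hξ).1 (abs_le.1 hξ).2
      rw [hRd] at this
      nlinarith
    have hs0 : 0 < √(1 + ξ ^ 2) := Real.sqrt_pos.2 (by positivity)
    apply div_le_div_of_nonneg_left ht0.le (by positivity)
    calc √(1 + ξ ^ 2) ^ 3 ≤ (2.5 * 2 ^ k) ^ 3 := by gcongr
      _ = 15.625 * (2 ^ k) ^ 3 := by ring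
      _ ≤ _ := by rw [e8]; gcongr; norm_num
  -- the scale
  set r : ℝ := (2 : ℝ) ^ (-((k : ℝ)) / 2) with hr
  have hr0 : 0 < r := by positivity
  have hr2 : r ^ 2 * 2 ^ k = 1 := by
    rw [hr, ← Real.rpow_natCast, ← Real.rpow_mul (by norm_num), ← Real.rpow_natCast,
      ← Real.rpow_add (by norm_num)]
    push_cast
    ring_nf; simp
  have hst : 0 < √t := Real.sqrt_pos.2 ht0
  have hsl : √lam = √t / (4 * 4 ^ k * r) := by
    rw [hlam, Real.sqrt_div ht0.le]
    congr 1
    apply (Real.sqrt_eq_iff_mul_self_eq (by positivity) (by positivity)).2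
    rw [e4, e8]
    linear_combination (-(16 * (2 ^ k) ^ 3) : ℝ) * hr2
  have hprop : ‖propagatorPk φ k t (⇑f) x‖ ≤ ‖∫ ξ in (-R)..R,
      Complex.exp (Complex.I * ((x * ξ + t * √(1 + ξ ^ 2) : ℝ) : ℂ)) * h ξ‖ := by
    unfold propagatorPk
    rw [norm_mul]
    have e : (∫ ξ : ℝ, Complex.exp (Complex.I * ((x * ξ + t * √(1 + ξ ^ 2) : ℝ) : ℂ)) *
        (lpSymb φ k ξ : ℂ) * FT f ξ) = ∫ ξ in (-R)..R,
        Complex.exp (Complex.I * ((x * ξ + t * √(1 + ξ ^ 2) : ℝ) : ℂ)) * h ξ := by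
      rw [intervalIntegral.integral_eq_integral_of_support_subset]
      · congr 1; ext ξ; rw [mul_assoc]
      · intro ξ hξ
        by_contra hcon
        apply hξ
        have : h ξ = 0 := by
          apply hout
          by_contra hc
          push Not at hc
          exact hcon ⟨(abs_lt.1 hc).1, (abs_lt.1 hc).2.le⟩
        simp [this]
    rw [e]
    apply mul_le_of_le_one_left (norm_nonneg _)
    rw [norm_inv, Complex.norm_real, Real.norm_of_nonneg (Real.sqrt_nonneg _)]
    apply inv_le_one_of_one_le₀
    rw [Real.one_le_sqrt]
    linarith [Real.pi_gt_three]
  refine hprop.trans ?_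
  have hw1 : ∀ ξ : ℝ, ‖((1 + ξ ^ 2 : ℝ) : ℂ)‖ = 1 + ξ ^ 2 := fun ξ => by
    rw [Complex.norm_real, Real.norm_of_nonneg (by positivity)]
  have hh'le : ∀ ξ, ‖h' ξ‖ ≤ 3 * D * ‖g ξ‖ + ‖deriv g ξ‖ := by
    intro ξ
    refine (norm_add_le _ _).trans ?_
    rw [norm_mul, norm_mul, Complex.norm_real, Complex.norm_real, Real.norm_eq_abs,
      Real.norm_eq_abs]
    have a := mul_le_mul_of_nonneg_right (aux_lpD_le φ D hD k ξ) (norm_nonneg (g ξ))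
    have b := mul_le_mul_of_nonneg_right (aux_lp_le φ hφ0 hφ1 k ξ) (norm_nonneg (deriv g ξ))
    linarith
  have hhle : ∀ ξ, ‖h ξ‖ ≤ ‖g ξ‖ := by
    intro ξ
    simp only [hh]
    rw [norm_mul, Complex.norm_real, Real.norm_eq_abs]
    have b := mul_le_mul_of_nonneg_right (aux_lp_le φ hφ0 hφ1 k ξ) (norm_nonneg (g ξ))
    linarith
  rcases le_or_gt 2 k with hk | hk
  · -- high frequencies
    set c : ℝ := 4 / 4 ^ k with hc
    have hc0 : 0 < c := by positivity
    set F0 : ℝ → ℝ := fun ξ => ‖((1 + ξ ^ 2 : ℝ) : ℂ) * g ξ‖ with hF0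
    set F1 : ℝ → ℝ := fun ξ => ‖(cutoff φ n 0 ξ : ℂ) * ((1 + ξ ^ 2 : ℝ) : ℂ) * deriv g ξ‖ with hF1
    have hA2 : ∫ ξ, F0 ξ ^ 2 ≤ B ^ 2 := (Real.sqrt_le_left hB0).1 hAB
    have hM2 : ∫ ξ, F1 ξ ^ 2 ≤ B ^ 2 := by
      have := hMB 0 (by omega)
      simp only [pow_zero, Real.sqrt_one, one_mul] at this
      exact (Real.sqrt_le_left hB0).1 this
    have i0 : Integrable (fun ξ => F0 ξ ^ 2) volume := (memLp_two_iff_integrable_sq hmemw.1).1 hmemw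
    have i1 : Integrable (fun ξ => F1 ξ ^ 2) volume :=
      (memLp_two_iff_integrable_sq (hmemc 0).1).1 (hmemc 0)
    have k4 : (4:ℝ) ≤ 2 ^ k := by
      calc (4:ℝ) = 2 ^ 2 := by norm_num
        _ ≤ 2 ^ k := pow_le_pow_right₀ (by norm_num) hk
    have pt : ∀ ξ, ‖h ξ‖ ≤ c * F0 ξ ∧ ‖h' ξ‖ ≤ c * (3 * D * F0 ξ + F1 ξ) := by
      intro ξ
      have hF00 : 0 ≤ F0 ξ := norm_nonneg _
      have hF10 : 0 ≤ F1 ξ := norm_nonneg _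
      rcases lt_or_ge (2 * |ξ|) (2 ^ k) with hξ | hξ
      · obtain ⟨z1, z2⟩ := aux_lp_in φ hφone k ξ hξ
        constructor
        · simp only [hh, z1]; simp; positivity
        · simp only [hh', z1, z2]; simp; positivity
      · have hcw : 1 ≤ c * (1 + ξ ^ 2) := by
          rw [hc, div_mul_eq_mul_div, le_div_iff₀ (by positivity), e4]
          nlinarith [sq_abs ξ]
        have hcut : cutoff φ n 0 ξ = 1 := by
          simp only [cutoff, if_true]
          rw [hφzero, sub_zero]
          have hs3 : √3 ≤ 1.8 := Real.sqrt_le_iff.2 ⟨by norm_num, by norm_num⟩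
          refine le_trans ?_ (le_abs_self _)
          have : 0.2 ≤ |ξ| - √3 := by linarith
          calc (2:ℝ) ≤ 2 ^ 101 * 0.2 := by norm_num
            _ ≤ _ := by gcongr
        have E0 : F0 ξ = (1 + ξ ^ 2) * ‖g ξ‖ := by simp only [hF0]; rw [norm_mul, hw1]
        have E1 : F1 ξ = (1 + ξ ^ 2) * ‖deriv g ξ‖ := by
          simp only [hF1]; rw [hcut, Complex.ofReal_one, one_mul, norm_mul, hw1]
        have q0 : ‖g ξ‖ ≤ c * F0 ξ := by
          rw [E0, ← mul_assoc]; exact le_mul_of_one_le_left (norm_nonneg _) hcw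
        have q1 : ‖deriv g ξ‖ ≤ c * F1 ξ := by
          rw [E1, ← mul_assoc]; exact le_mul_of_one_le_left (norm_nonneg _) hcw
        refine ⟨(hhle ξ).trans q0, (hh'le ξ).trans ?_⟩
        have := mul_le_mul_of_nonneg_left q0 (by positivity : 0 ≤ 3 * D)
        linarith
    have hS : 0 ≤ c * (5 * D + 2) * B := by positivity
    have sqle : ∀ (u : ℝ → ℂ) (v : ℝ → ℝ), Continuous u → Integrable v volume →
        (∀ ξ, ‖u ξ‖ ^ 2 ≤ v ξ) → ∫ ξ in (-R)..R, ‖u ξ‖ ^ 2 ≤ ∫ ξ, v ξ := by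
      intro u v hu hv huv
      rw [intervalIntegral.integral_of_le (by linarith)]
      refine le_trans (setIntegral_mono ?_ hv.integrableOn huv) ?_
      · exact ((hu.norm.pow 2).integrableOn_Icc).mono_set Set.Ioc_subset_Icc_self
      · exact setIntegral_le_integral hv
          (Eventually.of_forall fun ξ => (sq_nonneg _).trans (huv ξ))
    have S1 : √(∫ y in (-R)..R, ‖h y‖ ^ 2) ≤ c * (5 * D + 2) * B := by
      rw [Real.sqrt_le_left hS]
      refine (sqle h (fun ξ => c ^ 2 * F0 ξ ^ 2) ch (i0.const_mul _) ?_).trans ?_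
      · intro ξ; rw [← mul_pow]; exact pow_le_pow_left₀ (norm_nonneg _) (pt ξ).1 2
      · rw [integral_const_mul, mul_pow, mul_pow, mul_assoc]
        gcongr
        refine hA2.trans (le_mul_of_one_le_left (by positivity) ?_)
        nlinarith
    have S2 : √(∫ y in (-R)..R, ‖h' y‖ ^ 2) ≤ c * (5 * D + 2) * B := by
      rw [Real.sqrt_le_left hS]
      refine (sqle h' (fun ξ => c ^ 2 * (18 * D ^ 2 * F0 ξ ^ 2 + 2 * F1 ξ ^ 2)) ch'
        (((i0.const_mul _).add (i1.const_mul _)).const_mul _) ?_).trans ?_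
      · intro ξ
        refine (pow_le_pow_left₀ (norm_nonneg _) (pt ξ).2 2).trans ?_
        rw [mul_pow]
        gcongr
        nlinarith [sq_nonneg (3 * D * F0 ξ - F1 ξ)]
      · rw [integral_const_mul, mul_pow, mul_pow, mul_assoc]
        gcongr
        rw [integral_add (i0.const_mul _) (i1.const_mul _), integral_const_mul, integral_const_mul]
        have := mul_le_mul_of_nonneg_left hA2 (by positivity : 0 ≤ 18 * D ^ 2)
        nlinarith [mul_nonneg hD0 (sq_nonneg B), mul_nonneg (sq_nonneg D) (sq_nonneg B),
          sq_nonneg B]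
    have fin := aux_vdc2 _ _ _ h h' R lam hR hl P1 P2 P3 P4 hdl dh ch' h1 h2 _ hS S1 S2
    refine fin.trans ?_
    rw [hsl, hc]
    have e : 16 * (4 / 4 ^ k * (5 * D + 2) * B) / (√t / (4 * 4 ^ k * r)) =
        256 * (5 * D + 2) * (r * 1 / √t) * B := by
      field_simp; ring
    rw [e]
    have hCC : 256 * (5 * D + 2) ≤ 1280 * (D + 1) := by linarith
    gcongr
  · -- low frequencies
    have hR4 : R ≤ 4 := by
      rw [hRd]
      have : (2:ℝ) ^ k ≤ 2 ^ 1 := pow_le_pow_right₀ (by norm_num) (by omega)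
      linarith
    have k4 : (4:ℝ) ^ k ≤ 4 := by
      calc (4:ℝ) ^ k ≤ 4 ^ 1 := pow_le_pow_right₀ (by norm_num) (by omega)
        _ = 4 := by norm_num
    have cc := aux_cutoff_cont φ hφc n
    have V1 : ∫ ξ in (-R)..R, ‖((1 + ξ ^ 2 : ℝ) : ℂ) * g ξ‖ ≤ 3 * B :=
      (aux_int_L1 R hR.le hR4 _ (fun _ => norm_nonneg _) hmemw).trans (by linarith)
    have V2 : ∀ ℓ ∈ Finset.range (n + 1), ∫ ξ in (-R)..R, ‖(cutoff φ n ℓ ξ : ℂ) *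
        ((1 + ξ ^ 2 : ℝ) : ℂ) * deriv g ξ‖ ≤ B + if ℓ = 0 then 2 * B else 0 := by
      intro ℓ hℓ
      split_ifs with h0
      · subst h0
        refine (aux_int_L1 R hR.le hR4 _ (fun _ => norm_nonneg _) (hmemc 0)).trans ?_
        have := hMB 0 (by omega)
        simp only [pow_zero, Real.sqrt_one, one_mul] at this
        linarith
      · rw [add_zero]
        exact hnear ℓ h0 (Finset.mem_range.1 hℓ) R hR.le
    have pt : ∀ ξ, ‖h' ξ‖ ≤ 3 * D * ‖((1 + ξ ^ 2 : ℝ) : ℂ) * g ξ‖ +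
        ∑ ℓ ∈ Finset.range (n + 1), ‖(cutoff φ n ℓ ξ : ℂ) *
        ((1 + ξ ^ 2 : ℝ) : ℂ) * deriv g ξ‖ := by
      intro ξ
      have hw : 1 ≤ 1 + ξ ^ 2 := by nlinarith [sq_nonneg ξ]
      have a : ‖g ξ‖ ≤ ‖((1 + ξ ^ 2 : ℝ) : ℂ) * g ξ‖ := by
        rw [norm_mul, hw1]; exact le_mul_of_one_le_left (norm_nonneg _) hw
      have b : ‖deriv g ξ‖ ≤ ∑ ℓ ∈ Finset.range (n + 1), ‖(cutoff φ n ℓ ξ : ℂ) *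
          ((1 + ξ ^ 2 : ℝ) : ℂ) * deriv g ξ‖ := by
        have e : deriv g ξ = ∑ ℓ ∈ Finset.range (n + 1), (cutoff φ n ℓ ξ : ℂ) * deriv g ξ := by
          rw [← Finset.sum_mul, ← Complex.ofReal_sum, aux_cutoff_sum φ n hn ξ]; simp
        calc ‖deriv g ξ‖ = ‖∑ ℓ ∈ Finset.range (n + 1), (cutoff φ n ℓ ξ : ℂ) * deriv g ξ‖ := by
              rw [← e]
          _ ≤ ∑ ℓ ∈ Finset.range (n + 1), ‖(cutoff φ n ℓ ξ : ℂ) * deriv g ξ‖ := norm_sum_le _ _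
          _ ≤ _ := by
              apply Finset.sum_le_sum
              intro ℓ _
              rw [norm_mul, norm_mul, norm_mul, hw1]
              gcongr
              exact le_mul_of_one_le_right (norm_nonneg _) hw
      refine (hh'le ξ).trans ?_
      have := mul_le_mul_of_nonneg_left a (by positivity : 0 ≤ 3 * D)
      linarith
    have V : ∫ ξ in (-R)..R, ‖h' ξ‖ ≤ 9 * (D + 1) * n * B := by
      have c0 : Continuous fun ξ => ‖((1 + ξ ^ 2 : ℝ) : ℂ) * g ξ‖ := by fun_prop
      have cl : ∀ ℓ, Continuous fun ξ => ‖(cutoff φ n ℓ ξ : ℂ) *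
          ((1 + ξ ^ 2 : ℝ) : ℂ) * deriv g ξ‖ := by
        intro ℓ; have := cc ℓ; fun_prop
      have c1 : Continuous fun ξ => 3 * D * ‖((1 + ξ ^ 2 : ℝ) : ℂ) * g ξ‖ := by fun_prop
      have c2 : Continuous fun ξ => ∑ ℓ ∈ Finset.range (n + 1), ‖(cutoff φ n ℓ ξ : ℂ) *
          ((1 + ξ ^ 2 : ℝ) : ℂ) * deriv g ξ‖ := continuous_finsetSum _ fun ℓ _ => cl ℓ
      have c3 : Continuous fun ξ => 3 * D * ‖((1 + ξ ^ 2 : ℝ) : ℂ) * g ξ‖ +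
          ∑ ℓ ∈ Finset.range (n + 1), ‖(cutoff φ n ℓ ξ : ℂ) *
          ((1 + ξ ^ 2 : ℝ) : ℂ) * deriv g ξ‖ := c1.add c2
      have m := intervalIntegral.integral_mono (μ := volume) (a := -R) (b := R) (by linarith)
        (ch'.norm.intervalIntegrable _ _) (c3.intervalIntegrable _ _) pt
      refine m.trans ?_
      rw [intervalIntegral.integral_add (c1.intervalIntegrable _ _) (c2.intervalIntegrable _ _),
        intervalIntegral.integral_const_mul,
        intervalIntegral.integral_finsetSum fun ℓ _ => (cl ℓ).intervalIntegrable _ _]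
      have s := Finset.sum_le_sum V2
      rw [Finset.sum_add_distrib, Finset.sum_ite_eq' (Finset.range (n + 1)) 0] at s
      simp only [Finset.sum_const, Finset.card_range, nsmul_eq_mul, Finset.mem_range,
        Nat.succ_pos, if_true] at s
      rw [Nat.cast_add, Nat.cast_one] at s
      have a := mul_le_mul_of_nonneg_left V1 (by positivity : 0 ≤ 3 * D)
      have nB : B ≤ n * B := le_mul_of_one_le_left hB0 hn1
      have nDB := mul_le_mul_of_nonneg_left nB hD0
      nlinarith
    have fin := aux_vdc1 _ _ _ h h' R lam hR hl P1 P2 P3 P4 hdl dh ch' h1 h2 _ V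
    refine fin.trans ?_
    rw [hsl]
    have e : 8 * (9 * (D + 1) * n * B) / (√t / (4 * 4 ^ k * r)) =
        288 * 4 ^ k * (D + 1) * (r * n / √t) * B := by
      field_simp; ring
    rw [e]
    gcongr
    linarith
end
end
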